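/- arXiv:1711.03890 — 4 statements merged into one kernel-verified Lean document; each statement's English description precedes it below -/
import Mathlib

section
/- For any positive semi-definite Hermitian Toeplitz matrix R of size n×n, there exists a non-negative measure Φ on the circle (-π,π] such that R = (1/2π)∫ a(θ)Φ(dθ)a(θ)^H, where a(θ) = (1, e^{iθ}, ..., e^{i(n-1)θ})^T. -/
open MeasureTheory Matrix
open scoped ComplexOrder

/-- The Fourier vector `a(θ) = (1, e^{iθ}, ..., e^{i(n-1)θ})`. -/
noncomputable def aVec (n : ℕ) (θ : ℝ) : Fin n → ℂ :=
  fun k => Complex.exp (Complex.I * ((k : ℕ) : ℂ) * (θ : ℂ))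

/-- `Γ(μ) = (1/2π) ∫ a(θ) a(θ)ᴴ dμ(θ)`, computed entrywise:
`Γ(μ)_{jk} = (1/2π) ∫ e^{i(j-k)θ} dμ(θ)`. -/
noncomputable def Gamma (n : ℕ) (μ : Measure ℝ) : Matrix (Fin n) (Fin n) ℂ :=
  Matrix.of fun j k : Fin n =>
    ((1 / (2 * Real.pi) : ℝ) : ℂ) *
      ∫ θ, Complex.exp (Complex.I * (((j : ℕ) : ℂ) - ((k : ℕ) : ℂ)) * (θ : ℂ)) ∂μ

/-- A matrix is Toeplitz if its entries depend only on the difference of the indices. -/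
def IsToeplitz {n : ℕ} (R : Matrix (Fin n) (Fin n) ℂ) : Prop :=
  ∀ j k j' k' : Fin n, (j : ℤ) - (k : ℤ) = (j' : ℤ) - (k' : ℤ) → R j k = R j' k'

/-- Diagonalizability of a linear isometry of a finite-dimensional complex space. -/
theorem LinearIsometry.isSemisimple {V : Type*} [NormedAddCommGroup V] [InnerProductSpace ℂ V]
    [FiniteDimensional ℂ V] (U : V →ₗᵢ[ℂ] V) :
    Module.End.IsSemisimple (U.toLinearMap : Module.End ℂ V) := by
  rw [Module.End.isSemisimple_iff]
  intro p hp
  refine ⟨pᗮ, fun x hx => ?_, Submodule.isCompl_orthogonal p⟩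
  have hmap : p.map U.toLinearMap = p :=
    Submodule.eq_of_le_of_finrank_eq (Submodule.map_le_iff_le_comap.2 hp)
      (Submodule.equivMapOfInjective _ U.injective p).finrank_eq.symm
  rw [Submodule.mem_comap, Submodule.mem_orthogonal]
  intro y hy
  rw [← hmap] at hy
  obtain ⟨z, hz, rfl⟩ := hy
  simpa using (Submodule.mem_orthogonal _ _).1 hx z hz

/-- The correlations `⟪U ^ j v, U ^ k v⟫` of an orbit of a linear isometry are finite positive
combinations of characters of the unit circle. -/
theorem LinearIsometry.exists_spectral_weights {V : Type*} [NormedAddCommGroup V]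
    [InnerProductSpace ℂ V] [FiniteDimensional ℂ V] (U : V →ₗᵢ[ℂ] V) (v : V) :
    ∃ (s : Finset ℂ) (w : ℂ → NNReal), (∀ z ∈ s, ‖z‖ = 1) ∧ ∀ j k : ℕ,
      inner ℂ (U^[j] v) (U^[k] v) = ∑ z ∈ s, (w z : ℂ) * (star z ^ j * z ^ k) := by
  have hv : v ∈ ⨆ z, Module.End.eigenspace (U.toLinearMap : Module.End ℂ V) z := by
    rw [U.isSemisimple.iSup_eigenspace_eq_top]; trivial
  obtain ⟨f, hf, rfl⟩ := (Submodule.mem_iSup_iff_exists_finsupp _ _).1 hv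
  have hU (z : ℂ) : U (f z) = z • f z := Module.End.mem_eigenspace_iff.1 (hf z)
  have hnorm : ∀ z ∈ f.support, ‖z‖ = 1 := by
    intro z hz
    have h := U.norm_map (f z)
    rw [hU, norm_smul] at h
    exact (mul_eq_right₀ (norm_ne_zero_iff.2 (Finsupp.mem_support_iff.1 hz))).1 h
  have horth : ∀ z ∈ f.support, ∀ z' ∈ f.support, z ≠ z' → inner ℂ (f z) (f z') = 0 := by
    intro z hz z' _ hne
    have h := U.inner_map_map (f z) (f z')
    rw [hU, hU, inner_smul_left, inner_smul_right, ← mul_assoc] at h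
    by_contra h0
    have h1 : star z * z' = 1 := (mul_eq_right₀ h0).1 h
    have h2 : z * star z = 1 := by
      simpa [hnorm z hz] using Complex.mul_conj' z
    exact hne (by linear_combination (-z) * h1 + z' * h2)
  have hiter (j : ℕ) : U^[j] (f.sum fun _ x => x) = ∑ z ∈ f.support, z ^ j • f z := by
    induction j with
    | zero => simp [Finsupp.sum]
    | succ j ih =>
      rw [Function.iterate_succ_apply', ih, map_sum]
      exact Finset.sum_congr rfl fun z _ => by rw [map_smul, hU, smul_smul, pow_succ]
  refine ⟨f.support, fun z => ‖f z‖₊ ^ 2, hnorm, fun j k => ?_⟩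
  rw [hiter, hiter, sum_inner]
  refine Finset.sum_congr rfl fun z hz => ?_
  rw [inner_sum, Finset.sum_eq_single_of_mem z hz]
  · rw [inner_smul_left, inner_smul_right, inner_self_eq_norm_sq_to_K]
    simp
    ring
  · intro z' hz' hne
    rw [inner_smul_left, inner_smul_right, horth z hz z' hz' hne.symm]
    simp

/-- A finite sequence whose Gram matrix is Toeplitz is an initial segment of an orbit of a linear
isometry. -/
theorem exists_linearIsometry_iterate_eq {V : Type*} [NormedAddCommGroup V]
    [InnerProductSpace ℂ V] [FiniteDimensional ℂ V] {m : ℕ} (v : Fin (m + 1) → V)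
    (h : ∀ j k : Fin m, inner ℂ (v j.succ) (v k.succ) = inner ℂ (v j.castSucc) (v k.castSucc)) :
    ∃ U : V →ₗᵢ[ℂ] V, ∀ j : Fin (m + 1), U^[j] (v 0) = v j := by
  let T := Fintype.linearCombination ℂ fun j : Fin m => v j.castSucc
  let T' := Fintype.linearCombination ℂ fun j : Fin m => v j.succ
  have hnorm (c : Fin m → ℂ) : ‖T' c‖ = ‖T c‖ := by
    have : inner ℂ (T' c) (T' c) = inner ℂ (T c) (T c) := by
      simp only [T, T', Fintype.linearCombination_apply, sum_inner, inner_sum, inner_smul_left,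
        inner_smul_right, h]
    rw [inner_self_eq_norm_sq_to_K, inner_self_eq_norm_sq_to_K] at this
    exact (sq_eq_sq₀ (norm_nonneg _) (norm_nonneg _)).1 (by exact_mod_cast this)
  obtain ⟨s, hs⟩ := T.rangeRestrict.exists_rightInverse_of_surjective T.range_rangeRestrict
  have hTs (x : T.range) : T (s x) = x := congrArg Subtype.val (LinearMap.congr_fun hs x)
  let L : T.range →ₗᵢ[ℂ] V :=
    { toLinearMap := T' ∘ₗ s
      norm_map' := fun x => by
        rw [LinearMap.comp_apply, hnorm, hTs, Submodule.coe_norm] }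
  have hL (c : Fin m → ℂ) : L ⟨T c, c, rfl⟩ = T' c := by
    change T' (s ⟨T c, c, rfl⟩) = T' c
    rw [← sub_eq_zero, ← map_sub, ← norm_eq_zero, hnorm, map_sub, hTs, sub_self, norm_zero]
  have hstep (j : Fin m) : L.extend (v j.castSucc) = v j.succ := by
    have hT : T (Pi.single j 1) = v j.castSucc := by
      simp [T]
    have hT' : T' (Pi.single j 1) = v j.succ := by
      simp [T']
    rw [← hT, ← hT', ← hL]
    exact L.extend_apply ⟨T (Pi.single j 1), _, rfl⟩
  refine ⟨L.extend, fun j => ?_⟩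
  induction j using Fin.induction with
  | zero => rfl
  | succ j ih =>
    rw [Fin.val_succ, Function.iterate_succ_apply', ← hstep, ← ih, Fin.val_castSucc]

open scoped MatrixOrder Matrix.Norms.L2Operator in
/-- A positive semidefinite matrix is the Gram matrix of a family of vectors. -/
theorem Matrix.PosSemidef.exists_eq_inner {n : ℕ} {R : Matrix (Fin n) (Fin n) ℂ}
    (hR : R.PosSemidef) :
    ∃ v : Fin n → EuclideanSpace ℂ (Fin n), ∀ j k, R j k = inner ℂ (v j) (v k) := by
  obtain ⟨B, rfl⟩ := CStarAlgebra.nonneg_iff_eq_star_mul_self.mp hR.nonneg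
  refine ⟨fun j => WithLp.toLp 2 fun i => B i j, fun j k => ?_⟩
  simp [Matrix.mul_apply, PiLp.inner_apply, mul_comm]

/-- On the unit circle, `conj z ^ j * z ^ k` is a character at the angle of `conj z`. -/
theorem exp_arg_star_eq {z : ℂ} (hz : ‖z‖ = 1) (j k : ℕ) :
    Complex.exp (Complex.I * ((j : ℂ) - (k : ℂ)) * ((star z).arg : ℂ)) = star z ^ j * z ^ k := by
  have hexp : Complex.exp ((star z).arg * Complex.I) = star z := by
    simpa [hz] using Complex.norm_mul_exp_arg_mul_I (star z)
  have hinv : star z * z = 1 := by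
    simpa [hz] using Complex.conj_mul' z
  have hne : star z ≠ 0 := left_ne_zero_of_mul_eq_one hinv
  rw [show Complex.I * ((j : ℂ) - (k : ℂ)) * ((star z).arg : ℂ) =
      j * ((star z).arg * Complex.I) - k * ((star z).arg * Complex.I) by ring,
    Complex.exp_sub, Complex.exp_nat_mul, Complex.exp_nat_mul, hexp, div_eq_iff (pow_ne_zero k hne),
    mul_assoc, ← mul_pow, mul_comm z, hinv, one_pow, mul_one]

/-- every positive semi-definite (Hermitian) Toeplitz matrix `R` admits a
non-negative (finite) measure `Φ` on `(-π, π]` with `R = (1/2π) ∫ a(θ) a(θ)ᴴ dΦ(θ)`. -/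
theorem psd_toeplitz_has_spectral_representation (n : ℕ) (R : Matrix (Fin n) (Fin n) ℂ)
    (hR : R.PosSemidef) (hT : IsToeplitz R) :
    ∃ μ : Measure ℝ, IsFiniteMeasure μ ∧ μ (Set.Ioc (-Real.pi) Real.pi)ᶜ = 0 ∧
      Gamma n μ = R := by
  cases n with
  | zero => exact ⟨0, inferInstance, by simp, Subsingleton.elim _ _⟩
  | succ m =>
    obtain ⟨v, hv⟩ := hR.exists_eq_inner
    obtain ⟨U, hU⟩ := exists_linearIsometry_iterate_eq v fun j k => by
      rw [← hv, ← hv]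
      exact hT _ _ _ _ (by simp)
    obtain ⟨s, w, hs, hw⟩ := U.exists_spectral_weights (v 0)
    let c : NNReal := ⟨2 * Real.pi, Real.two_pi_pos.le⟩
    refine ⟨∑ z ∈ s, (c * w z) • Measure.dirac (star z).arg, inferInstance, ?_, ?_⟩
    · rw [Measure.finsetSum_apply]
      refine Finset.sum_eq_zero fun z _ => ?_
      have : (star z).arg ∈ Set.Ioc (-Real.pi) Real.pi := Complex.arg_mem_Ioc _
      rw [Measure.smul_apply, Measure.dirac_apply' _ measurableSet_Ioc.compl,
        Set.indicator_of_notMem (by simpa using this), smul_zero]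
    · ext j k
      rw [hv, ← hU j, ← hU k, hw, Gamma, Matrix.of_apply, integral_finsetSum_measure]
      · rw [Finset.mul_sum]
        refine Finset.sum_congr rfl fun z hz => ?_
        rw [integral_smul_nnreal_measure, integral_dirac, exp_arg_star_eq (hs z hz)]
        have hpi : (Real.pi : ℂ) ≠ 0 := by exact_mod_cast Real.pi_ne_zero
        have hc : (c : ℝ) = 2 * Real.pi := rfl
        rw [NNReal.smul_def, Complex.real_smul, NNReal.coe_mul, hc]
        push_cast
        field_simp
      · intro z _
        exact (integrable_dirac (by simp)).smul_measure_nnreal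
end

section
/- If R is a singular positive semi-definite Hermitian Toeplitz matrix of size n×n, then there is a unique non-negative measure Φ on (-π,π] consistent with R, and this measure is supported on at most n−1 points. -/
open MeasureTheory Matrix
open scoped ComplexOrder

open Module.End in
theorem LinearIsometry.iSup_eigenspace_eq_top {E : Type*} [NormedAddCommGroup E]
    [InnerProductSpace ℂ E] [FiniteDimensional ℂ E] (U : E →ₗᵢ[ℂ] E) :
    ⨆ z : ℂ, eigenspace U.toLinearMap z = ⊤ := by
  have hss : IsSemisimple U.toLinearMap := by
    rw [isSemisimple_iff]
    intro p hp
    refine ⟨pᗮ, ?_, Submodule.isCompl_orthogonal _⟩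
    have hmap : p.map U.toLinearMap = p := by
      refine Submodule.eq_of_le_of_finrank_eq (Submodule.map_le_iff_le_comap.2 hp) ?_
      exact (Submodule.equivMapOfInjective U.toLinearMap U.injective p).finrank_eq.symm
    intro x hx
    rw [Submodule.mem_comap, Submodule.mem_orthogonal]
    intro u hu
    rw [← hmap] at hu
    obtain ⟨w, hw, rfl⟩ := hu
    simpa using (Submodule.mem_orthogonal _ _).1 hx w hw
  rw [← iSup_maxGenEigenspace_eq_top U.toLinearMap]
  simp_rw [hss.isFinitelySemisimple.maxGenEigenspace_eq_eigenspace]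

theorem LinearIsometry.norm_eq_one_of_apply_eq_smul {E : Type*} [NormedAddCommGroup E]
    [NormedSpace ℂ E] (U : E →ₗᵢ[ℂ] E) {v : E} (hv : v ≠ 0) {z : ℂ} (h : U v = z • v) :
    ‖z‖ = 1 := by
  have h1 := U.norm_map v
  rw [h, norm_smul] at h1
  exact (mul_eq_right₀ (norm_ne_zero_iff.2 hv)).1 h1

theorem LinearIsometry.inner_eq_zero_of_apply_eq_smul {E : Type*} [NormedAddCommGroup E]
    [InnerProductSpace ℂ E] (U : E →ₗᵢ[ℂ] E) {v w : E} {z y : ℂ} (hv : U v = z • v)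
    (hw : U w = y • w) (hz : ‖z‖ = 1) (hzy : z ≠ y) : inner ℂ v w = 0 := by
  have h := U.inner_map_map v w
  rw [hv, hw, inner_smul_left, inner_smul_right] at h
  by_contra h0
  have h1 : starRingEnd ℂ z * y = 1 := by
    apply mul_right_cancel₀ h0
    rw [mul_assoc, h, one_mul]
  have h2 : z * starRingEnd ℂ z = 1 := by
    rw [Complex.mul_conj, Complex.normSq_eq_norm_sq, hz]; simp
  apply hzy
  calc z = z * (starRingEnd ℂ z * y) := by rw [h1, mul_one]
    _ = y := by rw [← mul_assoc, h2, one_mul]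

/-- Moments of a vector under the powers of an isometry: a finite spectral decomposition. -/
theorem LinearIsometry.exists_inner_pow_eq_sum {E : Type*} [NormedAddCommGroup E]
    [InnerProductSpace ℂ E] [FiniteDimensional ℂ E] (U : E →ₗᵢ[ℂ] E) (e : E) :
    ∃ (S : Finset ℂ) (w : ℂ → ℝ), (∀ z ∈ S, ‖z‖ = 1) ∧ (∀ z, 0 ≤ w z) ∧
      ∀ j k : ℕ, inner ℂ (U^[j] e) (U^[k] e) =
        ∑ z ∈ S, (w z : ℂ) * (starRingEnd ℂ z ^ j * z ^ k) := by
  have he : e ∈ ⨆ z : ℂ, Module.End.eigenspace U.toLinearMap z := by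
    rw [U.iSup_eigenspace_eq_top]; trivial
  obtain ⟨f, hf, hsum⟩ := (Submodule.mem_iSup_iff_exists_finsupp _ _).1 he
  have hfU : ∀ z, U (f z) = z • f z := fun z => Module.End.mem_eigenspace_iff.1 (hf z)
  have hnorm : ∀ z ∈ f.support, ‖z‖ = 1 := fun z hz =>
    U.norm_eq_one_of_apply_eq_smul (Finsupp.mem_support_iff.1 hz) (hfU z)
  have hpow : ∀ k : ℕ, U^[k] e = ∑ z ∈ f.support, z ^ k • f z := by
    intro k
    induction k with
    | zero => simpa [Finsupp.sum] using hsum.symm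
    | succ k ih =>
      rw [Function.iterate_succ_apply', ih, map_sum]
      refine Finset.sum_congr rfl fun z _ => ?_
      rw [map_smul, hfU, smul_smul, pow_succ]
  refine ⟨f.support, fun z => ‖f z‖ ^ 2, hnorm, fun z => by positivity, fun j k => ?_⟩
  rw [hpow, hpow, sum_inner]
  refine Finset.sum_congr rfl fun z hz => ?_
  rw [inner_sum, Finset.sum_eq_single z]
  · rw [inner_smul_left, inner_smul_right, inner_self_eq_norm_sq_to_K, map_pow]
    push_cast
    simp only [Complex.coe_algebraMap]
    ring
  · intro y _ hy
    rw [inner_smul_left, inner_smul_right,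
      U.inner_eq_zero_of_apply_eq_smul (hfU z) (hfU y) (hnorm z hz) hy.symm]
    simp
  · exact fun h => absurd hz h

theorem LinearMap.exists_linearIsometry_comp_eq {V E : Type*} [AddCommGroup V] [Module ℂ V]
    [NormedAddCommGroup E] [InnerProductSpace ℂ E] [FiniteDimensional ℂ E]
    (F G : V →ₗ[ℂ] E) (h : ∀ c, ‖F c‖ = ‖G c‖) :
    ∃ U : E →ₗᵢ[ℂ] E, ∀ c, U (F c) = G c := by
  obtain ⟨s, hs⟩ := F.rangeRestrict.exists_rightInverse_of_surjective F.range_rangeRestrict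
  have hFs : ∀ y : F.range, F (s y) = y := fun y =>
    congrArg Subtype.val (LinearMap.congr_fun hs y)
  let L : F.range →ₗᵢ[ℂ] E := ⟨G ∘ₗ s, fun y => by
    rw [LinearMap.comp_apply, ← h, hFs, Submodule.coe_norm]⟩
  refine ⟨L.extend, fun c => ?_⟩
  have h1 : L.extend (F c) = L (F.rangeRestrict c) := L.extend_apply (F.rangeRestrict c)
  rw [h1]
  change G (s (F.rangeRestrict c)) = G c
  rw [← sub_eq_zero, ← map_sub, ← norm_eq_zero, ← h, map_sub, hFs]
  simp

theorem Matrix.PosSemidef.exists_eq_gram {n : ℕ} {R : Matrix (Fin n) (Fin n) ℂ}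
    (hR : R.PosSemidef) : ∃ b : Fin n → EuclideanSpace ℂ (Fin n), R = Matrix.gram ℂ b := by
  obtain ⟨B, rfl⟩ : ∃ B : Matrix (Fin n) (Fin n) ℂ, R = Bᴴ * B := by
    open scoped MatrixOrder in
    exact CStarAlgebra.nonneg_iff_eq_star_mul_self.mp hR.nonneg
  refine ⟨fun k => WithLp.toLp 2 fun i => B i k, ?_⟩
  ext j k
  simp [Matrix.gram_apply, Matrix.mul_apply, PiLp.inner_apply, mul_comm]

/-- The vectors representing a positive semidefinite Toeplitz matrix form an orbit of an
isometry. -/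
theorem IsToeplitz.exists_eq_inner_pow {m : ℕ} {R : Matrix (Fin (m + 1)) (Fin (m + 1)) ℂ}
    (hT : IsToeplitz R) (hR : R.PosSemidef) :
    ∃ (U : EuclideanSpace ℂ (Fin (m + 1)) →ₗᵢ[ℂ] EuclideanSpace ℂ (Fin (m + 1)))
      (e : EuclideanSpace ℂ (Fin (m + 1))),
      ∀ j k : Fin (m + 1), R j k = inner ℂ (U^[(j : ℕ)] e) (U^[(k : ℕ)] e) := by
  obtain ⟨b, rfl⟩ := hR.exists_eq_gram
  let F := Fintype.linearCombination ℂ fun k : Fin m => b k.castSucc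
  let G := Fintype.linearCombination ℂ fun k : Fin m => b k.succ
  have hshift : ∀ j k : Fin m,
      inner ℂ (b j.castSucc) (b k.castSucc) = inner ℂ (b j.succ) (b k.succ) := fun j k =>
    hT j.castSucc k.castSucc j.succ k.succ (by simp)
  have hFG : ∀ c, ‖F c‖ = ‖G c‖ := by
    intro c
    have h : inner ℂ (F c) (F c) = inner ℂ (G c) (G c) := by
      simp only [F, G, Fintype.linearCombination_apply, sum_inner, inner_sum, inner_smul_left,
        inner_smul_right, hshift]
    rw [@norm_eq_sqrt_re_inner ℂ, @norm_eq_sqrt_re_inner ℂ, h]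
  obtain ⟨U, hU⟩ := LinearMap.exists_linearIsometry_comp_eq F G hFG
  have hstep : ∀ k : Fin m, U (b k.castSucc) = b k.succ := fun k => by
    simpa [F, G] using hU (Pi.single k 1)
  have horbit : ∀ k : Fin (m + 1), U^[(k : ℕ)] (b 0) = b k := by
    intro k
    induction k using Fin.induction with
    | zero => simp
    | succ i ih =>
      rw [Fin.val_succ, Function.iterate_succ_apply']
      rw [Fin.val_castSucc] at ih
      rw [ih, hstep]
  exact ⟨U, b 0, fun j k => by rw [horbit, horbit, Matrix.gram_apply]⟩

theorem Complex.exp_I_mul_sub_mul (j k : ℕ) (θ : ℝ) :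
    Complex.exp (Complex.I * ((j : ℂ) - (k : ℂ)) * (θ : ℂ)) =
      Complex.exp (θ * Complex.I) ^ j * starRingEnd ℂ (Complex.exp (θ * Complex.I)) ^ k := by
  rw [← Complex.exp_conj, ← Complex.exp_nat_mul, ← Complex.exp_nat_mul, ← Complex.exp_add]
  congr 1
  simp only [map_mul, Complex.conj_ofReal, Complex.conj_I]
  ring

theorem MeasureTheory.integrable_exp_I_mul_sub_mul (μ : Measure ℝ) [IsFiniteMeasure μ] (j k : ℕ) :
    Integrable (fun θ : ℝ => Complex.exp (Complex.I * ((j : ℂ) - (k : ℂ)) * (θ : ℂ))) μ := by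
  refine Integrable.of_bound (by fun_prop) 1 (Filter.Eventually.of_forall fun θ => ?_)
  rw [Complex.exp_I_mul_sub_mul, norm_mul, norm_pow, norm_pow, RCLike.norm_conj,
    Complex.norm_exp_ofReal_mul_I]
  simp

theorem Complex.arg_exp_ofReal_mul_I_of_mem_Ioc {θ : ℝ} (hθ : θ ∈ Set.Ioc (-Real.pi) Real.pi) :
    (Complex.exp (θ * Complex.I)).arg = θ := by
  rw [Complex.arg_exp_mul_I, toIocMod_eq_self, neg_add_eq_sub, two_mul, add_sub_cancel_right]
  exact hθ

theorem Complex.exp_arg_mul_I_of_norm_eq_one {z : ℂ} (hz : ‖z‖ = 1) :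
    Complex.exp (z.arg * Complex.I) = z := by
  simpa [hz] using Complex.norm_mul_exp_arg_mul_I z

/-- The Carathéodory representation of a positive semidefinite Toeplitz matrix. -/
theorem IsToeplitz.exists_measure {m : ℕ} {R : Matrix (Fin (m + 1)) (Fin (m + 1)) ℂ}
    (hT : IsToeplitz R) (hR : R.PosSemidef) :
    ∃ μ : Measure ℝ, IsFiniteMeasure μ ∧ μ (Set.Ioc (-Real.pi) Real.pi)ᶜ = 0 ∧
      Gamma (m + 1) μ = R := by
  obtain ⟨U, e, hUe⟩ := hT.exists_eq_inner_pow hR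
  obtain ⟨S, w, hS, hw, hinner⟩ := U.exists_inner_pow_eq_sum e
  let μ : Measure ℝ := ∑ z ∈ S,
    ENNReal.ofReal (2 * Real.pi * w z) • Measure.dirac (starRingEnd ℂ z).arg
  have hfin : ∀ z, IsFiniteMeasure
      (ENNReal.ofReal (2 * Real.pi * w z) • Measure.dirac (starRingEnd ℂ z).arg) := fun z =>
    Measure.smul_finite _ ENNReal.ofReal_ne_top
  have hμ : IsFiniteMeasure μ := inferInstance
  refine ⟨μ, hμ, ?_, ?_⟩
  · rw [Measure.finsetSum_apply]
    refine Finset.sum_eq_zero fun z _ => ?_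
    rw [Measure.smul_apply, Measure.dirac_apply' _ measurableSet_Ioc.compl,
      Set.indicator_of_notMem (Set.notMem_compl_iff.2 (Complex.arg_mem_Ioc _)), smul_zero]
  · ext j k
    rw [Gamma, Matrix.of_apply, hUe, hinner,
      integral_finsetSum_measure fun z _ => integrable_exp_I_mul_sub_mul _ j k, Finset.mul_sum]
    refine Finset.sum_congr rfl fun z hz => ?_
    rw [integral_smul_measure, integral_dirac, Complex.exp_I_mul_sub_mul,
      Complex.exp_arg_mul_I_of_norm_eq_one (by rw [RCLike.norm_conj, hS z hz]),
      ENNReal.toReal_ofReal (mul_nonneg (by positivity) (hw z)), Complex.conj_conj,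
      Complex.real_smul, ← mul_assoc, ← Complex.ofReal_mul]
    congr 2
    field_simp

theorem star_dotProduct_Gamma_mulVec {n : ℕ} (μ : Measure ℝ) [IsFiniteMeasure μ]
    (c : Fin n → ℂ) :
    star c ⬝ᵥ (Gamma n μ *ᵥ c) = ((1 / (2 * Real.pi) *
      ∫ θ : ℝ, Complex.normSq
        (∑ k, c k * starRingEnd ℂ (Complex.exp (θ * Complex.I)) ^ (k : ℕ)) ∂μ : ℝ) : ℂ) := by
  have hpt : ∀ θ : ℝ, ((Complex.normSq
      (∑ k, c k * starRingEnd ℂ (Complex.exp (θ * Complex.I)) ^ (k : ℕ)) : ℝ) : ℂ) =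
      ∑ j : Fin n, ∑ k : Fin n, star (c j) * c k *
        Complex.exp (Complex.I * (((j : ℕ) : ℂ) - ((k : ℕ) : ℂ)) * (θ : ℂ)) := by
    intro θ
    rw [Complex.normSq_eq_conj_mul_self, map_sum, Finset.sum_mul_sum]
    refine Finset.sum_congr rfl fun j _ => Finset.sum_congr rfl fun k _ => ?_
    rw [Complex.exp_I_mul_sub_mul, map_mul, map_pow, Complex.conj_conj, Complex.star_def]
    ring
  have hint : ∀ j k : Fin n, Integrable (fun θ : ℝ => star (c j) * c k *
      Complex.exp (Complex.I * (((j : ℕ) : ℂ) - ((k : ℕ) : ℂ)) * (θ : ℂ))) μ := fun j k =>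
    (integrable_exp_I_mul_sub_mul μ j k).const_mul _
  rw [Complex.ofReal_mul, ← integral_complex_ofReal]
  simp_rw [hpt]
  rw [integral_finsetSum _ fun j _ => integrable_finsetSum _ fun k _ => hint j k]
  simp_rw [integral_finsetSum _ fun k _ => hint _ k, integral_const_mul]
  simp only [dotProduct, Matrix.mulVec, Gamma, Matrix.of_apply, Pi.star_apply, Finset.mul_sum]
  refine Finset.sum_congr rfl fun j _ => Finset.sum_congr rfl fun k _ => ?_
  ring

/-- A singular matrix confines all its consistent measures to a common finite set. -/
theorem exists_common_finite_support {n : ℕ} {R : Matrix (Fin n) (Fin n) ℂ} (hsing : R.det = 0) :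
    ∃ s : Finset ℝ, s.card ≤ n - 1 ∧ (s : Set ℝ) ⊆ Set.Ioc (-Real.pi) Real.pi ∧
      ∀ μ : Measure ℝ, IsFiniteMeasure μ → μ (Set.Ioc (-Real.pi) Real.pi)ᶜ = 0 →
        Gamma n μ = R → μ (s : Set ℝ)ᶜ = 0 := by
  obtain ⟨c, hc, hRc⟩ := Matrix.exists_mulVec_eq_zero_iff.2 hsing
  let q : Polynomial ℂ := ∑ k : Fin n, Polynomial.monomial (k : ℕ) (c k)
  have hcoeff : ∀ k : Fin n, q.coeff k = c k := by
    intro k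
    simp [q, Polynomial.finsetSum_coeff, Polynomial.coeff_monomial, Fin.val_inj]
  have hq : q ≠ 0 := by
    intro h
    apply hc
    ext k
    rw [← hcoeff, h]
    simp
  have hdeg : q.natDegree ≤ n - 1 :=
    Polynomial.natDegree_sum_le_of_forall_le _ _ fun k _ =>
      (Polynomial.natDegree_monomial_le _).trans (by omega)
  refine ⟨q.roots.toFinset.image fun z => (z⁻¹).arg, ?_, ?_, fun μ _ hμ hΓ => ?_⟩
  · exact Finset.card_image_le.trans
      ((Multiset.toFinset_card_le _).trans ((Polynomial.card_roots' _).trans hdeg))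
  · intro θ hθ
    obtain ⟨z, _, rfl⟩ := Finset.mem_image.1 (Finset.mem_coe.1 hθ)
    exact Complex.arg_mem_Ioc _
  · have heval : ∀ z, q.eval z = ∑ k, c k * z ^ (k : ℕ) := by
      intro z
      simp [q, Polynomial.eval_finsetSum]
    have hzero := star_dotProduct_Gamma_mulVec μ c
    rw [hΓ, hRc, dotProduct_zero, eq_comm, Complex.ofReal_eq_zero, mul_eq_zero,
      or_iff_right (by positivity)] at hzero
    simp_rw [← heval] at hzero
    have hcont : Continuous fun θ : ℝ => Complex.normSq
        (q.eval (starRingEnd ℂ (Complex.exp (θ * Complex.I)))) := by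
      refine Complex.continuous_normSq.comp (q.continuous.comp ?_)
      exact Complex.continuous_conj.comp (by fun_prop)
    obtain ⟨C, hC⟩ := (isCompact_sphere (0 : ℂ) 1).exists_bound_of_continuousOn
      (f := fun z => Complex.normSq (q.eval z))
      (Complex.continuous_normSq.comp q.continuous).continuousOn
    have hint : Integrable (fun θ : ℝ => Complex.normSq
        (q.eval (starRingEnd ℂ (Complex.exp (θ * Complex.I))))) μ := by
      refine Integrable.of_bound hcont.aestronglyMeasurable C
        (Filter.Eventually.of_forall fun θ => hC _ ?_)
      simp [Complex.norm_exp_ofReal_mul_I]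
    rw [integral_eq_zero_iff_of_nonneg (fun θ => Complex.normSq_nonneg _) hint] at hzero
    have hIoc : ∀ᵐ θ ∂μ, θ ∈ Set.Ioc (-Real.pi) Real.pi := hμ
    change ∀ᵐ θ ∂μ, θ ∈ _
    filter_upwards [hzero, hIoc] with θ h0 hθ
    refine Finset.mem_coe.2 (Finset.mem_image.2
      ⟨starRingEnd ℂ (Complex.exp (θ * Complex.I)), ?_, ?_⟩)
    · rw [Multiset.mem_toFinset, Polynomial.mem_roots hq]
      exact Complex.normSq_eq_zero.1 h0
    · rw [← Complex.exp_conj, ← Complex.exp_neg]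
      simp only [map_mul, Complex.conj_ofReal, Complex.conj_I, mul_neg, neg_neg]
      exact Complex.arg_exp_ofReal_mul_I_of_mem_Ioc hθ

theorem integral_exp_pow_eq_of_Gamma_eq {m : ℕ} {μ ν : Measure ℝ}
    (h : Gamma (m + 1) μ = Gamma (m + 1) ν) {k : ℕ} (hk : k ≤ m) :
    ∫ θ : ℝ, Complex.exp (θ * Complex.I) ^ k ∂μ = ∫ θ : ℝ, Complex.exp (θ * Complex.I) ^ k ∂ν := by
  have h1 := congrFun (congrFun h ⟨k, Nat.lt_succ_of_le hk⟩) 0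
  simp only [Gamma, Matrix.of_apply, Complex.exp_I_mul_sub_mul] at h1
  simpa [Real.pi_ne_zero] using h1

/-- Finite measures carried by at most `m + 1` common points of `(-π, π]` are determined by their
first `m + 1` trigonometric moments. -/
theorem measure_eq_of_Gamma_eq {m : ℕ} {μ ν : Measure ℝ} [IsFiniteMeasure μ] [IsFiniteMeasure ν]
    {s : Finset ℝ} (hcard : s.card ≤ m + 1) (hs : (s : Set ℝ) ⊆ Set.Ioc (-Real.pi) Real.pi)
    (hμ : μ (s : Set ℝ)ᶜ = 0) (hν : ν (s : Set ℝ)ᶜ = 0)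
    (h : Gamma (m + 1) μ = Gamma (m + 1) ν) : μ = ν := by
  classical
  have hinj : Set.InjOn (fun θ : ℝ => Complex.exp (θ * Complex.I)) s := by
    intro x hx y hy hxy
    rw [← Complex.arg_exp_ofReal_mul_I_of_mem_Ioc (hs hx),
      ← Complex.arg_exp_ofReal_mul_I_of_mem_Ioc (hs hy)]
    exact congrArg Complex.arg hxy
  have hpoint : ∀ x ∈ s, μ {x} = ν {x} := by
    intro x hx
    let P := Lagrange.basis s (fun θ : ℝ => Complex.exp (θ * Complex.I)) x
    have hdeg : P.natDegree ≤ m := by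
      rw [Lagrange.natDegree_basis hinj hx]
      omega
    have hmass : ∀ ρ : Measure ℝ, IsFiniteMeasure ρ → ρ (s : Set ℝ)ᶜ = 0 →
        (ρ.real {x} : ℂ) = ∑ k ∈ Finset.range (m + 1),
          P.coeff k * ∫ θ : ℝ, Complex.exp (θ * Complex.I) ^ k ∂ρ := by
      intro ρ _ hρ
      have hint : ∀ k : ℕ, Integrable (fun θ : ℝ => Complex.exp (θ * Complex.I) ^ k) ρ := by
        intro k
        have h0 := integrable_exp_I_mul_sub_mul ρ k 0
        simp_rw [Complex.exp_I_mul_sub_mul] at h0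
        simpa using h0
      have hρs : ∀ᵐ θ ∂ρ, θ ∈ (s : Set ℝ) := hρ
      simp_rw [← integral_const_mul]
      rw [← integral_finsetSum _ fun k _ => (hint k).const_mul _]
      have hae : (fun θ : ℝ => ∑ k ∈ Finset.range (m + 1),
          P.coeff k * Complex.exp (θ * Complex.I) ^ k) =ᵐ[ρ]
          Set.indicator {x} fun _ => (1 : ℂ) := by
        filter_upwards [hρs] with θ hθ
        rw [← Polynomial.eval_eq_sum_range' (Nat.lt_succ_of_le hdeg)]
        by_cases hxθ : θ = x
        · subst hxθ
          rw [Set.indicator_of_mem (Set.mem_singleton _)]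
          exact Lagrange.eval_basis_self hinj hθ
        · rw [Set.indicator_of_notMem (by simpa using hxθ)]
          exact Lagrange.eval_basis_of_ne (v := fun θ : ℝ => Complex.exp (θ * Complex.I))
            (Ne.symm hxθ) hθ
      rw [integral_congr_ae hae, integral_indicator_const _ (measurableSet_singleton x)]
      simp
    have hreal : μ.real {x} = ν.real {x} := by
      rw [← Complex.ofReal_inj, hmass μ inferInstance hμ, hmass ν inferInstance hν]
      refine Finset.sum_congr rfl fun k hk => ?_
      rw [integral_exp_pow_eq_of_Gamma_eq h (Nat.lt_succ_iff.1 (Finset.mem_range.1 hk))]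
    exact (measureReal_eq_measureReal_iff).1 hreal
  ext A _
  have hA : ∀ ρ : Measure ℝ, ρ (s : Set ℝ)ᶜ = 0 → ρ A = ∑ x ∈ s with x ∈ A, ρ {x} := by
    intro ρ hρ
    rw [sum_measure_singleton, ← measure_inter_conull hρ]
    congr 1
    ext x
    simp [and_comm]
  rw [hA μ hμ, hA ν hν]
  exact Finset.sum_congr rfl fun x hx => hpoint x (Finset.mem_filter.1 hx).1

/-- a singular positive semi-definite Hermitian Toeplitz matrix has a *unique*
consistent non-negative measure on `(-π, π]`, and any such measure is supported on at most
`n - 1` points. -/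
theorem singular_psd_toeplitz_unique_spectrum (n : ℕ) (R : Matrix (Fin n) (Fin n) ℂ)
    (hR : R.PosSemidef) (hT : IsToeplitz R) (hsing : R.det = 0) :
    (∃! μ : Measure ℝ, IsFiniteMeasure μ ∧ μ (Set.Ioc (-Real.pi) Real.pi)ᶜ = 0 ∧
        Gamma n μ = R) ∧
    ∀ μ : Measure ℝ, IsFiniteMeasure μ → μ (Set.Ioc (-Real.pi) Real.pi)ᶜ = 0 →
      Gamma n μ = R →
      ∃ s : Finset ℝ, s.card ≤ n - 1 ∧ μ (↑s : Set ℝ)ᶜ = 0 := by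
  obtain ⟨s, hcard, hs, hsupp⟩ := exists_common_finite_support hsing
  refine ⟨?_, fun μ hμ hμs hΓ => ⟨s, hcard, hsupp μ hμ hμs hΓ⟩⟩
  cases n with
  | zero => simp at hsing
  | succ m =>
    obtain ⟨μ, hμ, hμs, hΓ⟩ := hT.exists_measure hR
    refine ⟨μ, ⟨hμ, hμs, hΓ⟩, ?_⟩
    rintro ν ⟨hν, hνs, hνΓ⟩
    exact measure_eq_of_Gamma_eq (hcard.trans (by omega)) hs (hsupp ν hν hνs hνΓ)
      (hsupp μ hμ hμs hΓ) (hνΓ.trans hΓ.symm)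
end

section
/- Let p ≥ 1, κ > 0, and c(θ,φ) = |θ−φ|^p. Define S_κ(Φ₀,Φ₁) = min over Ψ₀, Ψ₁ ≥ 0 of S(Ψ₀,Ψ₁) + κ(‖Φ₀−Ψ₀‖₁ + ‖Φ₁−Ψ₁‖₁). Then W_κ(Φ₀,Φ₁) = S_κ(Φ₀,Φ₁)^{1/p} is a metric on the set of non-negative bounded measures on T: it is non-negative, symmetric, vanishes exactly when Φ₀ = Φ₁, and satisfies the triangle inequality. -/
open MeasureTheory Matrix
open scoped ENNReal ComplexOrder

/-- The circle `T = (-π, π]`, modeled as `ℝ / 2πℤ`. -/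
abbrev Tcircle := AddCircle (2 * Real.pi)

/-- The optimal mass transport cost `S(Φ₀, Φ₁)` with cost function `c`: the infimum of
`∫∫ c dM` over all transport plans `M` (non-negative measures on `T × T`) whose marginals
are `Φ₀` and `Φ₁`.  (It equals `∞` when no transport plan exists, e.g. when the total
masses differ.) -/
noncomputable def otCost (c : Tcircle → Tcircle → ℝ) (Φ₀ Φ₁ : Measure Tcircle) : ℝ≥0∞ :=
  sInf { x | ∃ M : Measure (Tcircle × Tcircle),
      M.map Prod.fst = Φ₀ ∧ M.map Prod.snd = Φ₁ ∧
      x = ∫⁻ p, ENNReal.ofReal (c p.1 p.2) ∂M }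

/-- Total variation norm `‖μ - ν‖₁` of the difference of two (non-negative) measures,
via the Jordan-type decomposition `(μ - ν)(T) + (ν - μ)(T)`. -/
noncomputable def tvDist (μ ν : Measure Tcircle) : ℝ≥0∞ :=
  (μ - ν) Set.univ + (ν - μ) Set.univ

/-- `S_κ(Φ₀,Φ₁) = inf over Ψ₀, Ψ₁ ≥ 0 of S(Ψ₀,Ψ₁) + κ(‖Φ₀−Ψ₀‖₁ + ‖Φ₁−Ψ₁‖₁)`, for the
cost `c(θ,φ) = |θ − φ|^p` on the circle. -/
noncomputable def Skappa (p κ : ℝ) (Φ₀ Φ₁ : Measure Tcircle) : ℝ≥0∞ :=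
  ⨅ (Ψ₀ : Measure Tcircle) (Ψ₁ : Measure Tcircle),
    otCost (fun x y => ‖x - y‖ ^ p) Ψ₀ Ψ₁ +
      ENNReal.ofReal κ * (tvDist Φ₀ Ψ₀ + tvDist Φ₁ Ψ₁)

/-- `W_κ = S_κ^{1/p}`. -/
noncomputable def Wkappa (p κ : ℝ) (Φ₀ Φ₁ : Measure Tcircle) : ℝ≥0∞ :=
  Skappa p κ Φ₀ Φ₁ ^ (1 / p)

open ProbabilityTheory

namespace MeasureTheory.Measure

variable {α β γ : Type*} [MeasurableSpace α] [MeasurableSpace β] [MeasurableSpace γ]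

lemma sub_add_eq_sup (μ ν : Measure α) [IsFiniteMeasure ν] : μ - ν + ν = μ ⊔ ν := by
  have h : (μ ⊔ ν) - ν ≤ μ - ν := le_sInf fun d hd =>
    sub_le_of_le_add (sup_le hd (le_add_of_nonneg_left bot_le))
  have h' : (μ ⊔ ν) - ν + ν = μ ⊔ ν := sub_add_cancel_of_le le_sup_right
  refine le_antisymm ?_ ?_
  · calc μ - ν + ν ≤ (μ ⊔ ν) - ν + ν := by
          gcongr
          exact sub_le_of_le_add (le_sup_left.trans h'.ge)
      _ = _ := h'
  · calc μ ⊔ ν = (μ ⊔ ν) - ν + ν := h'.symm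
      _ ≤ _ := by gcongr

lemma le_sub_add (μ ν : Measure α) [IsFiniteMeasure ν] : μ ≤ μ - ν + ν :=
  le_sup_left.trans (sub_add_eq_sup μ ν).ge

/-- A measure below a marginal of `ρ` is the marginal of a measure below `ρ`. -/
lemma exists_le_map_eq {ρ : Measure α} [IsFiniteMeasure ρ] {f : α → β} (hf : Measurable f)
    {μ : Measure β} (hμ : μ ≤ ρ.map f) : ∃ ρ' ≤ ρ, ρ'.map f = μ := by
  have : IsFiniteMeasure μ := isFiniteMeasure_of_le _ hμ
  refine ⟨ρ.withDensity (μ.rnDeriv (ρ.map f) ∘ f), ?_, ?_⟩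
  · conv_rhs => rw [← withDensity_one (μ := ρ)]
    exact withDensity_mono (ae_of_ae_map hf.aemeasurable (rnDeriv_le_one_of_le hμ))
  · ext s hs
    rw [map_apply hf hs, withDensity_apply _ (hf hs)]
    simp only [Function.comp_apply]
    rw [← setLIntegral_map hs (measurable_rnDeriv _ _) hf,
      setLIntegral_rnDeriv (absolutelyContinuous_of_le hμ)]

/-- Gluing of two measures along a common marginal. -/
lemma exists_glue [StandardBorelSpace α] [Nonempty α] [StandardBorelSpace γ] [Nonempty γ]
    {ρ : Measure (α × β)} {σ : Measure (β × γ)} [IsFiniteMeasure ρ] [IsFiniteMeasure σ]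
    (h : ρ.snd = σ.fst) :
    ∃ G : Measure (β × α × γ), G.map (fun w => (w.2.1, w.1)) = ρ ∧
      G.map (fun w => (w.1, w.2.2)) = σ := by
  set ρ' := ρ.map Prod.swap with hρ'
  have h' : ρ'.fst = σ.fst := by rw [hρ', fst_map_swap, h]
  refine ⟨σ.fst ⊗ₘ (ρ'.condKernel ×ₖ σ.condKernel), ?_, ?_⟩
  · have e : (fun w : β × α × γ => (w.2.1, w.1)) = Prod.swap ∘ Prod.map id Prod.fst := rfl
    rw [e, ← map_map measurable_swap (by fun_prop), ← compProd_map measurable_fst,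
      ← Kernel.fst_eq, Kernel.fst_prod, ← h', disintegrate, hρ',
      map_map measurable_swap measurable_swap]
    simp
  · have e : (fun w : β × α × γ => (w.1, w.2.2)) = Prod.map id Prod.snd := rfl
    rw [e, ← compProd_map measurable_snd, ← Kernel.snd_eq, Kernel.snd_prod, disintegrate]

end MeasureTheory.Measure

lemma ofReal_norm_sub_rpow {p : ℝ} (hp : 0 ≤ p) (x y : Tcircle) :
    ENNReal.ofReal (‖x - y‖ ^ p) = edist x y ^ p := by
  rw [edist_dist, dist_eq_norm, ENNReal.ofReal_rpow_of_nonneg (norm_nonneg _) hp]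

lemma tvDist_of_le {μ ν : Measure Tcircle} (h : ν ≤ μ) : tvDist μ ν = (μ - ν) Set.univ := by
  simp [tvDist, Measure.sub_eq_zero_of_le h]

/-- The cost of a plan transporting only part of the masses of `Φ₀` and `Φ₁`, the remaining
masses being charged at rate `κ`. -/
noncomputable def partialCost (p κ : ℝ) (Φ₀ Φ₁ : Measure Tcircle)
    (M : Measure (Tcircle × Tcircle)) : ℝ≥0∞ :=
  ∫⁻ z, edist z.1 z.2 ^ p ∂M +
    ENNReal.ofReal κ * ((Φ₀ - M.fst) Set.univ + (Φ₁ - M.snd) Set.univ)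

lemma Skappa_le_partialCost {p : ℝ} (hp : 0 ≤ p) (κ : ℝ) {Φ₀ Φ₁ : Measure Tcircle}
    {M : Measure (Tcircle × Tcircle)} (h₀ : M.fst ≤ Φ₀) (h₁ : M.snd ≤ Φ₁) :
    Skappa p κ Φ₀ Φ₁ ≤ partialCost p κ Φ₀ Φ₁ M := by
  refine (iInf₂_le M.fst M.snd).trans ?_
  rw [tvDist_of_le h₀, tvDist_of_le h₁, partialCost]
  gcongr
  refine sInf_le ⟨M, rfl, rfl, ?_⟩
  simp only [ofReal_norm_sub_rpow hp]

lemma isFiniteMeasure_of_tvDist_ne_top {Φ Ψ : Measure Tcircle} [IsFiniteMeasure Φ]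
    (h : tvDist Φ Ψ ≠ ∞) : IsFiniteMeasure Ψ := by
  refine ⟨(Measure.le_sub_add Ψ Φ Set.univ).trans_lt ?_⟩
  rw [Measure.add_apply]
  exact ENNReal.add_lt_top.2 ⟨(ENNReal.add_ne_top.1 h).2.lt_top, measure_lt_top _ _⟩

lemma sub_apply_univ_add {Φ Ψ : Measure Tcircle} [IsFiniteMeasure Φ] [IsFiniteMeasure Ψ] :
    (Φ - Ψ) Set.univ + Ψ Set.univ = Φ Set.univ + (Ψ - Φ) Set.univ := by
  have := congrArg (fun μ : Measure Tcircle => μ Set.univ)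
    ((Measure.sub_add_eq_sup Φ Ψ).trans (sup_comm Φ Ψ) |>.trans (Measure.sub_add_eq_sup Ψ Φ).symm)
  simpa [add_comm] using this

lemma exists_partialCost_le {p : ℝ} (κ : ℝ) {Φ₀ Φ₁ : Measure Tcircle}
    [IsFiniteMeasure Φ₀] [IsFiniteMeasure Φ₁] {M : Measure (Tcircle × Tcircle)}
    [IsFiniteMeasure M] :
    ∃ M' : Measure (Tcircle × Tcircle), IsFiniteMeasure M' ∧ M'.fst ≤ Φ₀ ∧ M'.snd ≤ Φ₁ ∧
      partialCost p κ Φ₀ Φ₁ M' ≤ ∫⁻ z, edist z.1 z.2 ^ p ∂M +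
        ENNReal.ofReal κ * (tvDist Φ₀ M.fst + tvDist Φ₁ M.snd) := by
  obtain ⟨M₁, hM₁, hfst⟩ := Measure.exists_le_map_eq (ρ := M) measurable_fst
    (μ := M.fst - (M.fst - Φ₀)) Measure.sub_le
  have : IsFiniteMeasure M₁ := isFiniteMeasure_of_le _ hM₁
  obtain ⟨M₂, hM₂, hsnd⟩ := Measure.exists_le_map_eq (ρ := M₁) measurable_snd
    (μ := M₁.snd - (M₁.snd - Φ₁)) Measure.sub_le
  have : IsFiniteMeasure M₂ := isFiniteMeasure_of_le _ hM₂
  change M₁.fst = _ at hfst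
  change M₂.snd = _ at hsnd
  have h₀ : M₂.fst ≤ Φ₀ := by
    refine (Measure.map_mono hM₂ measurable_fst).trans ?_
    change M₁.fst ≤ _
    rw [hfst]
    exact Measure.sub_le_of_le_add (by rw [add_comm]; exact Measure.le_sub_add _ _)
  have h₁ : M₂.snd ≤ Φ₁ := by
    rw [hsnd]
    exact Measure.sub_le_of_le_add (by rw [add_comm]; exact Measure.le_sub_add _ _)
  refine ⟨M₂, inferInstance, h₀, h₁, ?_⟩
  rw [partialCost]
  refine add_le_add (lintegral_mono' (hM₂.trans hM₁) le_rfl) (mul_le_mul_right ?_ _)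
  have e₁ : M₁ Set.univ + (M.fst - Φ₀) Set.univ = M Set.univ := by
    rw [← Measure.fst_univ, ← Measure.fst_univ (ρ := M), hfst, ← Measure.add_apply,
      Measure.sub_add_cancel_of_le Measure.sub_le]
  have e₂ : M₂ Set.univ + (M₁.snd - Φ₁) Set.univ = M₁ Set.univ := by
    rw [← Measure.snd_univ, ← Measure.snd_univ (ρ := M₁), hsnd, ← Measure.add_apply,
      Measure.sub_add_cancel_of_le Measure.sub_le]
  have e₃ : (M₁.snd - Φ₁) Set.univ ≤ (M.snd - Φ₁) Set.univ := by
    refine Measure.sub_le_of_le_add ?_ _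
    exact (Measure.map_mono hM₁ measurable_snd).trans (Measure.le_sub_add _ _)
  have e₄ := sub_apply_univ_add (Φ := Φ₀) (Ψ := M.fst)
  have e₅ := sub_apply_univ_add (Φ := Φ₁) (Ψ := M.snd)
  rw [Measure.fst_univ] at e₄
  rw [Measure.snd_univ] at e₅
  rw [Measure.sub_apply MeasurableSet.univ h₀, Measure.sub_apply MeasurableSet.univ h₁,
    Measure.fst_univ, Measure.snd_univ, tvDist, tvDist]
  have f₀ : M₂ Set.univ ≤ Φ₀ Set.univ := by
    simpa only [Measure.fst_univ] using h₀ Set.univ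
  have f₁ : M₂ Set.univ ≤ Φ₁ Set.univ := by
    simpa only [Measure.snd_univ] using h₁ Set.univ
  have t₁ := measure_ne_top M₁ Set.univ
  have t₂ := measure_ne_top M₂ Set.univ
  have t₃ := measure_ne_top M Set.univ
  have t₄ := measure_ne_top Φ₀ Set.univ
  have t₅ := measure_ne_top Φ₁ Set.univ
  have t₆ := measure_ne_top (M.fst - Φ₀) Set.univ
  have t₇ := measure_ne_top (M.snd - Φ₁) Set.univ
  have t₈ := measure_ne_top (Φ₀ - M.fst) Set.univ
  have t₉ := measure_ne_top (Φ₁ - M.snd) Set.univ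
  have t₁₀ := measure_ne_top (M₁.snd - Φ₁) Set.univ
  generalize M₁ Set.univ = a₁ at *
  generalize M₂ Set.univ = a₂ at *
  generalize M Set.univ = a₃ at *
  generalize Φ₀ Set.univ = a₄ at *
  generalize Φ₁ Set.univ = a₅ at *
  generalize (M.fst - Φ₀) Set.univ = a₆ at *
  generalize (M.snd - Φ₁) Set.univ = a₇ at *
  generalize (Φ₀ - M.fst) Set.univ = a₈ at *
  generalize (Φ₁ - M.snd) Set.univ = a₉ at *
  generalize (M₁.snd - Φ₁) Set.univ = a₁₀ at *
  lift a₁ to NNReal using t₁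
  lift a₂ to NNReal using t₂
  lift a₃ to NNReal using t₃
  lift a₄ to NNReal using t₄
  lift a₅ to NNReal using t₅
  lift a₆ to NNReal using t₆
  lift a₇ to NNReal using t₇
  lift a₈ to NNReal using t₈
  lift a₉ to NNReal using t₉
  lift a₁₀ to NNReal using t₁₀
  norm_cast at *
  rw [← NNReal.coe_le_coe] at *
  rw [← NNReal.coe_inj] at *
  push_cast [NNReal.coe_sub f₀, NNReal.coe_sub f₁] at *
  linarith

lemma exists_partialCost_lt {p κ : ℝ} (hp : 0 ≤ p) (hκ : 0 < κ) {Φ₀ Φ₁ : Measure Tcircle}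
    [IsFiniteMeasure Φ₀] [IsFiniteMeasure Φ₁] {r : ℝ≥0∞} (h : Skappa p κ Φ₀ Φ₁ < r) :
    ∃ M : Measure (Tcircle × Tcircle), IsFiniteMeasure M ∧ M.fst ≤ Φ₀ ∧ M.snd ≤ Φ₁ ∧
      partialCost p κ Φ₀ Φ₁ M < r := by
  simp only [Skappa, iInf_lt_iff] at h
  obtain ⟨Ψ₀, Ψ₁, h⟩ := h
  have htv : tvDist Φ₀ Ψ₀ ≠ ∞ := by
    intro ht
    simp [ht, ENNReal.mul_top, hκ] at h
  have : IsFiniteMeasure Ψ₀ := isFiniteMeasure_of_tvDist_ne_top htv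
  have h' := lt_tsub_iff_right.2 h
  obtain ⟨_, ⟨M, rfl, rfl, rfl⟩, hM⟩ := sInf_lt_iff.1 h'
  have : IsFiniteMeasure M := ⟨by rw [← Measure.fst_univ]; exact measure_lt_top (M.map _) _⟩
  obtain ⟨M', hfin, h₀, h₁, hle⟩ := exists_partialCost_le (p := p) κ (Φ₀ := Φ₀) (Φ₁ := Φ₁) (M := M)
  refine ⟨M', hfin, h₀, h₁, hle.trans_lt ?_⟩
  simp only [ofReal_norm_sub_rpow hp] at hM
  exact lt_tsub_iff_right.1 hM

lemma otCost_comm (p : ℝ) (Φ₀ Φ₁ : Measure Tcircle) :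
    otCost (fun x y => ‖x - y‖ ^ p) Φ₀ Φ₁ = otCost (fun x y => ‖x - y‖ ^ p) Φ₁ Φ₀ := by
  have key : ∀ Φ Φ' : Measure Tcircle,
      otCost (fun x y => ‖x - y‖ ^ p) Φ Φ' ≤ otCost (fun x y => ‖x - y‖ ^ p) Φ' Φ := by
    intro Φ Φ'
    refine le_sInf ?_
    rintro _ ⟨M, rfl, rfl, rfl⟩
    refine sInf_le ⟨M.map Prod.swap, Measure.fst_map_swap, Measure.snd_map_swap, ?_⟩
    refine Eq.trans ?_ (lintegral_map_equiv _ MeasurableEquiv.prodComm).symm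
    refine lintegral_congr fun z => ?_
    change _ = ENNReal.ofReal (‖z.2 - z.1‖ ^ p)
    rw [norm_sub_rev]
  exact le_antisymm (key _ _) (key _ _)

lemma Skappa_comm (p κ : ℝ) (Φ₀ Φ₁ : Measure Tcircle) :
    Skappa p κ Φ₀ Φ₁ = Skappa p κ Φ₁ Φ₀ := by
  rw [Skappa, iInf_comm, Skappa]
  simp_rw [otCost_comm p _, add_comm (tvDist Φ₀ _)]

lemma Skappa_self {p : ℝ} (hp : 0 < p) (κ : ℝ) (Φ : Measure Tcircle) : Skappa p κ Φ Φ = 0 := by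
  have hd : Measurable fun x : Tcircle => (x, x) := by fun_prop
  have h₀ : (Φ.map fun x => (x, x)).fst = Φ := by
    rw [Measure.fst, Measure.map_map measurable_fst hd]; exact Measure.map_id
  have h₁ : (Φ.map fun x => (x, x)).snd = Φ := by
    rw [Measure.snd, Measure.map_map measurable_snd hd]; exact Measure.map_id
  refine le_antisymm ((Skappa_le_partialCost hp.le κ h₀.le h₁.le).trans ?_) bot_le
  rw [partialCost, h₀, h₁, lintegral_map (by fun_prop) hd]
  simp [Measure.sub_self, hp]

/-- The cost raised to the power `1 / p` on the disjoint union of the circle (flag `false`) and of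
a reservoir (flag `true`), where creating or destroying a unit mass costs `κ`. -/
noncomputable def reservoirDist (p κ : ℝ) (u v : Tcircle × Bool) : ℝ≥0∞ :=
  if u.2 = true then (if v.2 = true then 0 else ENNReal.ofReal κ ^ (1 / p))
  else if v.2 = true then ENNReal.ofReal κ ^ (1 / p)
  else min (edist u.1 v.1) ((2 * ENNReal.ofReal κ) ^ (1 / p))

lemma measurable_reservoirDist (p κ : ℝ) :
    Measurable fun w : (Tcircle × Bool) × (Tcircle × Bool) => reservoirDist p κ w.1 w.2 := by
  have h₀ : MeasurableSet {w : (Tcircle × Bool) × (Tcircle × Bool) | w.1.2 = true} :=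
    measurableSet_eq_fun (by fun_prop) measurable_const
  have h₁ : MeasurableSet {w : (Tcircle × Bool) × (Tcircle × Bool) | w.2.2 = true} :=
    measurableSet_eq_fun (by fun_prop) measurable_const
  refine Measurable.ite h₀ (Measurable.ite h₁ ?_ ?_) (Measurable.ite h₁ ?_ ?_) <;> fun_prop

lemma min_add_le_min_add_min {a b c x : ℝ≥0∞} (h : a ≤ b + c) :
    min a x ≤ min b x + min c x := by
  rcases le_total b x with hb | hb <;> rcases le_total c x with hc | hc <;>
    simp only [min_eq_left, min_eq_right, hb, hc]
  · exact (min_le_left _ _).trans h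
  · exact (min_le_right _ _).trans le_add_self
  · exact (min_le_right _ _).trans le_self_add
  · exact (min_le_right _ _).trans le_self_add

lemma reservoirDist_triangle {p : ℝ} (hp : 1 ≤ p) (κ : ℝ) (u v w : Tcircle × Bool) :
    reservoirDist p κ u w ≤ reservoirDist p κ u v + reservoirDist p κ v w := by
  have h2 : (2 * ENNReal.ofReal κ) ^ (1 / p) ≤
      ENNReal.ofReal κ ^ (1 / p) + ENNReal.ofReal κ ^ (1 / p) := by
    rw [two_mul]
    exact ENNReal.rpow_add_le_add_rpow _ _ (by positivity) (by rw [div_le_one] <;> linarith)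
  obtain ⟨x, a⟩ := u
  obtain ⟨y, b⟩ := v
  obtain ⟨z, c⟩ := w
  cases a <;> cases b <;> cases c <;> simp only [reservoirDist, if_true, if_false,
    Bool.false_eq_true, zero_add, add_zero, le_refl, le_add_self, le_self_add, zero_le]
  · exact min_add_le_min_add_min (edist_triangle _ _ _)
  · exact (min_le_right _ _).trans h2

lemma reservoirDist_rpow_false {p : ℝ} (hp : 0 < p) (κ : ℝ) (x y : Tcircle) :
    reservoirDist p κ (x, false) (y, false) ^ p =
      min (edist x y ^ p) (2 * ENNReal.ofReal κ) := by
  simp only [reservoirDist, if_false, Bool.false_eq_true]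
  rw [(ENNReal.monotone_rpow_of_nonneg hp.le).map_min, ← ENNReal.rpow_mul,
    one_div_mul_cancel hp.ne', ENNReal.rpow_one]

lemma reservoirDist_rpow_false_true {p : ℝ} (hp : 0 < p) (κ : ℝ) (x y : Tcircle) :
    reservoirDist p κ (x, false) (y, true) ^ p = ENNReal.ofReal κ := by
  simp only [reservoirDist, if_true, if_false, Bool.false_eq_true]
  rw [← ENNReal.rpow_mul, one_div_mul_cancel hp.ne', ENNReal.rpow_one]

lemma reservoirDist_rpow_true_false {p : ℝ} (hp : 0 < p) (κ : ℝ) (x y : Tcircle) :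
    reservoirDist p κ (x, true) (y, false) ^ p = ENNReal.ofReal κ := by
  simp only [reservoirDist, if_true, if_false, Bool.false_eq_true]
  rw [← ENNReal.rpow_mul, one_div_mul_cancel hp.ne', ENNReal.rpow_one]

lemma Skappa_le_lintegral_reservoirDist {p : ℝ} (hp : 0 < p) (κ : ℝ)
    {Φ₀ Φ₁ ξ₀ ξ₁ : Measure Tcircle}
    {N : Measure ((Tcircle × Bool) × (Tcircle × Bool))} [IsFiniteMeasure N]
    (h₀ : N.fst = Φ₀.map (·, false) + ξ₀.map (·, true))
    (h₁ : N.snd = Φ₁.map (·, false) + ξ₁.map (·, true)) :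
    Skappa p κ Φ₀ Φ₁ ≤ ∫⁻ w, reservoirDist p κ w.1 w.2 ^ p ∂N := by
  have slice (Φ ξ : Measure Tcircle) {s : Set Tcircle} (hs : MeasurableSet s) :
      (Φ.map (·, false) + ξ.map (·, true)) (s ×ˢ {false}) = Φ s := by
    have hm : MeasurableSet (s ×ˢ {false} : Set (Tcircle × Bool)) :=
      hs.prod (measurableSet_singleton _)
    rw [Measure.add_apply, Measure.map_apply (by fun_prop) hm, Measure.map_apply (by fun_prop) hm]
    simp [Set.preimage]
  have hmeas {s : Set Tcircle} (hs : MeasurableSet s) :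
      MeasurableSet (s ×ˢ {false} : Set (Tcircle × Bool)) := hs.prod (measurableSet_singleton _)
  have h₀' {s : Set Tcircle} (hs : MeasurableSet s) : N (Prod.fst ⁻¹' (s ×ˢ {false})) = Φ₀ s := by
    rw [← Measure.fst_apply (hmeas hs), h₀, slice _ _ hs]
  have h₁' {s : Set Tcircle} (hs : MeasurableSet s) : N (Prod.snd ⁻¹' (s ×ˢ {false})) = Φ₁ s := by
    rw [← Measure.snd_apply (hmeas hs), h₁, slice _ _ hs]
  set A₀ : Set ((Tcircle × Bool) × (Tcircle × Bool)) := Prod.fst ⁻¹' (Set.univ ×ˢ {false}) with hA₀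
  set A₁ : Set ((Tcircle × Bool) × (Tcircle × Bool)) := Prod.snd ⁻¹' (Set.univ ×ˢ {false}) with hA₁
  set E : Set ((Tcircle × Bool) × (Tcircle × Bool)) :=
    {w | edist w.1.1 w.2.1 ^ p ≤ 2 * ENNReal.ofReal κ} with hE
  have mA₀ : MeasurableSet A₀ := measurable_fst (hmeas MeasurableSet.univ)
  have mA₁ : MeasurableSet A₁ := measurable_snd (hmeas MeasurableSet.univ)
  have mE : MeasurableSet E := measurableSet_le (by fun_prop) measurable_const
  set B := A₀ ∩ A₁ ∩ E with hB
  have mB : MeasurableSet B := (mA₀.inter mA₁).inter mE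
  have hBA₀ : B ⊆ A₀ := fun w hw => hw.1.1
  have hBA₁ : B ⊆ A₁ := fun w hw => hw.1.2
  have mf : Measurable fun w : (Tcircle × Bool) × (Tcircle × Bool) => (w.1.1, w.2.1) := by fun_prop
  set M := (N.restrict B).map fun w => (w.1.1, w.2.1) with hM
  have hfst : M.fst ≤ Φ₀ := by
    refine Measure.le_iff.2 fun s hs => ?_
    rw [Measure.fst_apply hs, hM, Measure.map_apply mf (measurable_fst hs),
      Measure.restrict_apply (mf (measurable_fst hs)), ← h₀' hs]
    exact measure_mono fun w hw => ⟨hw.1, hw.2.1.1.2⟩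
  have hsnd : M.snd ≤ Φ₁ := by
    refine Measure.le_iff.2 fun s hs => ?_
    rw [Measure.snd_apply hs, hM, Measure.map_apply mf (measurable_snd hs),
      Measure.restrict_apply (mf (measurable_snd hs)), ← h₁' hs]
    exact measure_mono fun w hw => ⟨hw.1, hw.2.1.2.2⟩
  have hMB : M Set.univ = N B := by
    rw [hM, Measure.map_apply mf MeasurableSet.univ]; simp
  have : IsFiniteMeasure M := by rw [hM]; infer_instance
  refine (Skappa_le_partialCost hp.le κ hfst hsnd).trans ?_
  rw [partialCost, Measure.sub_apply MeasurableSet.univ hfst,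
    Measure.sub_apply MeasurableSet.univ hsnd, Measure.fst_univ, Measure.snd_univ, hMB,
    ← h₀' MeasurableSet.univ, ← h₁' MeasurableSet.univ,
    ← measure_sdiff hBA₀ mB.nullMeasurableSet (measure_ne_top _ _),
    ← measure_sdiff hBA₁ mB.nullMeasurableSet (measure_ne_top _ _), mul_add,
    ← lintegral_indicator_const (mA₀.diff mB), ← lintegral_indicator_const (mA₁.diff mB), hM,
    lintegral_map (by fun_prop) mf, ← lintegral_indicator mB,
    ← lintegral_add_left (measurable_const.indicator (mA₀.diff mB)),
    ← lintegral_add_left (Measurable.indicator (by fun_prop) mB)]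
  refine lintegral_mono ?_
  rintro ⟨⟨x, a⟩, ⟨y, b⟩⟩
  simp only
  cases a <;> cases b
  · rw [reservoirDist_rpow_false hp]
    by_cases h : edist x y ^ p ≤ 2 * ENNReal.ofReal κ
    · simp [hB, hE, hA₀, hA₁, h]
    · rw [min_eq_right (not_le.1 h).le, two_mul (ENNReal.ofReal κ)]
      simp [hB, hE, hA₀, hA₁, h]
  · rw [reservoirDist_rpow_false_true hp]
    simp [hB, hE, hA₀, hA₁]
  · rw [reservoirDist_rpow_true_false hp]
    simp [hB, hE, hA₀, hA₁]
  · simp [hB, hE, hA₀, hA₁]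

lemma exists_reservoir_plan {p : ℝ} (hp : 0 < p) (κ : ℝ) {Φ₀ Φ₁ : Measure Tcircle}
    [IsFiniteMeasure Φ₀] [IsFiniteMeasure Φ₁]
    {M : Measure (Tcircle × Tcircle)} [IsFiniteMeasure M] (h₀ : M.fst ≤ Φ₀) (h₁ : M.snd ≤ Φ₁)
    (ξ : Measure Tcircle) [IsFiniteMeasure ξ] :
    ∃ N : Measure ((Tcircle × Bool) × (Tcircle × Bool)), IsFiniteMeasure N ∧
      N.fst = Φ₀.map (·, false) + ((Φ₁ - M.snd) + ξ).map (·, true) ∧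
      N.snd = Φ₁.map (·, false) + ((Φ₀ - M.fst) + ξ).map (·, true) ∧
      ∫⁻ w, reservoirDist p κ w.1 w.2 ^ p ∂N ≤ partialCost p κ Φ₀ Φ₁ M := by
  have hc := (measurable_reservoirDist p κ).pow_const p
  have e₀ : M.fst + (Φ₀ - M.fst) = Φ₀ := by
    rw [add_comm, Measure.sub_add_cancel_of_le h₀]
  have e₁ : M.snd + (Φ₁ - M.snd) = Φ₁ := by
    rw [add_comm, Measure.sub_add_cancel_of_le h₁]
  have mF : Measurable fun x : Tcircle => (x, false) := by fun_prop
  have mT : Measurable fun x : Tcircle => (x, true) := by fun_prop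
  have m₁ : Measurable fun z : Tcircle × Tcircle => ((z.1, false), (z.2, false)) := by fun_prop
  have m₂ : Measurable fun x : Tcircle => ((x, false), (x, true)) := by fun_prop
  have m₃ : Measurable fun x : Tcircle => ((x, true), (x, false)) := by fun_prop
  have m₄ : Measurable fun x : Tcircle => ((x, true), (x, true)) := by fun_prop
  refine ⟨M.map (fun z => ((z.1, false), (z.2, false))) +
    (Φ₀ - M.fst).map (fun x => ((x, false), (x, true))) +
    (Φ₁ - M.snd).map (fun x => ((x, true), (x, false))) +
    ξ.map (fun x => ((x, true), (x, true))), inferInstance, ?_, ?_, ?_⟩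
  · conv_rhs => rw [← e₀]
    rw [Measure.fst, Measure.fst]
    simp only [Measure.map_add _ _ measurable_fst, Measure.map_add _ _ mF, Measure.map_add _ _ mT,
      Measure.map_map measurable_fst m₁, Measure.map_map measurable_fst m₂,
      Measure.map_map measurable_fst m₃, Measure.map_map measurable_fst m₄,
      Measure.map_map mF measurable_fst, add_assoc]
    rfl
  · conv_rhs => rw [← e₁]
    rw [Measure.snd, Measure.snd]
    simp only [Measure.map_add _ _ measurable_snd, Measure.map_add _ _ mF, Measure.map_add _ _ mT,
      Measure.map_map measurable_snd m₁, Measure.map_map measurable_snd m₂,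
      Measure.map_map measurable_snd m₃, Measure.map_map measurable_snd m₄,
      Measure.map_map mF measurable_snd, add_assoc]
    rw [add_left_comm (Measure.map _ (Φ₀ - _))]
    rfl
  · rw [lintegral_add_measure, lintegral_add_measure, lintegral_add_measure, lintegral_map hc m₁,
      lintegral_map hc m₂, lintegral_map hc m₃, lintegral_map hc m₄]
    simp only [reservoirDist_rpow_false hp, reservoirDist_rpow_false_true hp,
      reservoirDist_rpow_true_false hp, lintegral_const]
    have hz (x : Tcircle) : reservoirDist p κ (x, true) (x, true) ^ p = 0 := by
      simp [reservoirDist, hp]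
    simp only [hz, lintegral_zero, add_zero, partialCost, mul_add, add_assoc]
    gcongr
    exact min_le_left _ _

lemma Skappa_rpow_le_add_partialCost {p : ℝ} (hp : 1 ≤ p) (κ : ℝ) {Φ₀ Φ₁ Φ₂ : Measure Tcircle}
    [IsFiniteMeasure Φ₀] [IsFiniteMeasure Φ₁] [IsFiniteMeasure Φ₂]
    {M M' : Measure (Tcircle × Tcircle)} [IsFiniteMeasure M] [IsFiniteMeasure M']
    (h₀ : M.fst ≤ Φ₀) (h₁ : M.snd ≤ Φ₁) (h₁' : M'.fst ≤ Φ₁) (h₂ : M'.snd ≤ Φ₂) :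
    Skappa p κ Φ₀ Φ₂ ^ (1 / p) ≤
      partialCost p κ Φ₀ Φ₁ M ^ (1 / p) + partialCost p κ Φ₁ Φ₂ M' ^ (1 / p) := by
  have hp0 : 0 < p := by linarith
  have hip : 0 ≤ 1 / p := by positivity
  have hD := measurable_reservoirDist p κ
  obtain ⟨N, _, hN₀, hN₁, hN⟩ := exists_reservoir_plan hp0 κ h₀ h₁ (Φ₂ - M'.snd)
  obtain ⟨N', _, hN'₀, hN'₁, hN'⟩ := exists_reservoir_plan hp0 κ h₁' h₂ (Φ₀ - M.fst)
  obtain ⟨G, hG, hG'⟩ := Measure.exists_glue (ρ := N) (σ := N')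
    (by rw [hN₁, hN'₀, add_comm (Φ₀ - M.fst)])
  have mG : Measurable fun w : (Tcircle × Bool) × (Tcircle × Bool) × (Tcircle × Bool) =>
    (w.2.1, w.1) := by fun_prop
  have mG' : Measurable fun w : (Tcircle × Bool) × (Tcircle × Bool) × (Tcircle × Bool) =>
    (w.1, w.2.2) := by fun_prop
  have : IsFiniteMeasure G := ⟨by
    have : N Set.univ = G Set.univ := by rw [← hG, Measure.map_apply mG .univ, Set.preimage_univ]
    rw [← this]
    exact measure_lt_top _ _⟩
  have hfst : (G.map Prod.snd).fst = N.fst := by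
    rw [← hG, Measure.fst, Measure.fst, Measure.map_map measurable_fst measurable_snd,
      Measure.map_map measurable_fst mG]
    rfl
  have hsnd : (G.map Prod.snd).snd = N'.snd := by
    rw [← hG', Measure.snd, Measure.snd, Measure.map_map measurable_snd measurable_snd,
      Measure.map_map measurable_snd mG']
    rfl
  calc Skappa p κ Φ₀ Φ₂ ^ (1 / p)
      ≤ (∫⁻ w, reservoirDist p κ w.1 w.2 ^ p ∂(G.map Prod.snd)) ^ (1 / p) := by
        gcongr
        exact Skappa_le_lintegral_reservoirDist hp0 κ (hfst.trans hN₀) (hsnd.trans hN'₁)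
    _ = (∫⁻ w, reservoirDist p κ w.2.1 w.2.2 ^ p ∂G) ^ (1 / p) := by
        rw [lintegral_map (hD.pow_const p) measurable_snd]
    _ ≤ (∫⁻ w, ((fun w : (Tcircle × Bool) × (Tcircle × Bool) × (Tcircle × Bool) =>
          reservoirDist p κ w.2.1 w.1) +
          fun w : (Tcircle × Bool) × (Tcircle × Bool) × (Tcircle × Bool) =>
            reservoirDist p κ w.1 w.2.2) w ^ p ∂G) ^ (1 / p) := by
        gcongr with w
        exact reservoirDist_triangle hp κ _ _ _
    _ ≤ (∫⁻ w, reservoirDist p κ w.2.1 w.1 ^ p ∂G) ^ (1 / p) +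
          (∫⁻ w, reservoirDist p κ w.1 w.2.2 ^ p ∂G) ^ (1 / p) :=
        ENNReal.lintegral_Lp_add_le (hD.comp mG).aemeasurable (hD.comp mG').aemeasurable hp
    _ = (∫⁻ w, reservoirDist p κ w.1 w.2 ^ p ∂N) ^ (1 / p) +
          (∫⁻ w, reservoirDist p κ w.1 w.2 ^ p ∂N') ^ (1 / p) := by
        rw [← hG, ← hG', lintegral_map (hD.pow_const p) mG, lintegral_map (hD.pow_const p) mG']
    _ ≤ _ := by gcongr

lemma Wkappa_triangle {p κ : ℝ} (hp : 1 ≤ p) (hκ : 0 < κ) (Φ₀ Φ₁ Φ₂ : Measure Tcircle)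
    [IsFiniteMeasure Φ₀] [IsFiniteMeasure Φ₁] [IsFiniteMeasure Φ₂] :
    Wkappa p κ Φ₀ Φ₂ ≤ Wkappa p κ Φ₀ Φ₁ + Wkappa p κ Φ₁ Φ₂ := by
  have hp0 : 0 < p := by linarith
  refine ENNReal.le_of_forall_pos_le_add fun ε hε hfin => ?_
  obtain ⟨h₀t, h₁t⟩ := ENNReal.add_lt_top.1 hfin
  have hε' : (ε / 2 : ℝ≥0∞) ≠ 0 := by simp [hε.ne']
  have ha := ENNReal.lt_add_right h₀t.ne hε'
  have hb := ENNReal.lt_add_right h₁t.ne hε'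
  rw [← ENNReal.add_halves (ε : ℝ≥0∞), add_add_add_comm]
  generalize Wkappa p κ Φ₀ Φ₁ + (ε / 2 : ℝ≥0∞) = a at *
  generalize Wkappa p κ Φ₁ Φ₂ + (ε / 2 : ℝ≥0∞) = b at *
  have ha' : Skappa p κ Φ₀ Φ₁ < a ^ p := 
    (ENNReal.rpow_inv_lt_iff hp0).1 (by rwa [← one_div])
  have hb' : Skappa p κ Φ₁ Φ₂ < b ^ p := 
    (ENNReal.rpow_inv_lt_iff hp0).1 (by rwa [← one_div])
  obtain ⟨M, _, h₀, h₁, hM⟩ := exists_partialCost_lt hp0.le hκ ha'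
  obtain ⟨M', _, h₁', h₂, hM'⟩ := exists_partialCost_lt hp0.le hκ hb'
  refine (Skappa_rpow_le_add_partialCost hp κ h₀ h₁ h₁' h₂).trans ?_
  rw [one_div]
  exact add_le_add ((ENNReal.rpow_inv_le_iff hp0).2 hM.le) ((ENNReal.rpow_inv_le_iff hp0).2 hM'.le)

lemma measure_le_cthickening_of_Skappa_eq_zero {p κ : ℝ} (hp : 0 < p) (hκ : 0 < κ)
    {Φ₀ Φ₁ : Measure Tcircle} [IsFiniteMeasure Φ₀] [IsFiniteMeasure Φ₁]
    (h : Skappa p κ Φ₀ Φ₁ = 0) {F : Set Tcircle} (hF : MeasurableSet F) {δ : ℝ} (hδ : 0 < δ) :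
    Φ₀ F ≤ Φ₁ (Metric.cthickening δ F) := by
  set d := ENNReal.ofReal δ ^ p with hd
  have hd0 : d ≠ 0 := by simp [hd, hδ]
  have hdt : d ≠ ∞ := by simp [hd, hp.le]
  have hk0 : ENNReal.ofReal κ ≠ 0 := by simp [hκ]
  refine ENNReal.le_of_forall_pos_le_add fun ε hε _ => ?_
  have hε' : (0 : ℝ≥0∞) < min (d * (ε / 2)) (ENNReal.ofReal κ * (ε / 2)) := by
    have : (ε : ℝ≥0∞) / 2 ≠ 0 := by simp [hε.ne']
    exact lt_min (ENNReal.mul_pos hd0 this) (ENNReal.mul_pos hk0 this)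
  obtain ⟨M, _, h₀, h₁, hM⟩ := exists_partialCost_lt hp.le hκ (h.trans_lt hε')
  have hM₁ : M {z | d ≤ edist z.1 z.2 ^ p} ≤ ε / 2 := by
    have := (mul_meas_ge_le_lintegral (μ := M) (f := fun z => edist z.1 z.2 ^ p)
      (by fun_prop) d).trans (le_self_add.trans (hM.le.trans (min_le_left _ _)))
    exact (ENNReal.mul_le_mul_iff_right hd0 hdt).1 this
  have hM₂ : (Φ₀ - M.fst) F ≤ ε / 2 := by
    have : ENNReal.ofReal κ * ((Φ₀ - M.fst) Set.univ + (Φ₁ - M.snd) Set.univ) ≤ _ :=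
      le_add_self.trans (hM.le.trans (min_le_right _ _))
    refine (measure_mono (Set.subset_univ F)).trans (le_self_add.trans
      ((ENNReal.mul_le_mul_iff_right hk0 ENNReal.ofReal_ne_top).1 this))
  have hsub : Prod.fst ⁻¹' F ⊆
      Prod.snd ⁻¹' (Metric.cthickening δ F) ∪ {z : Tcircle × Tcircle | d ≤ edist z.1 z.2 ^ p} := by
    rintro ⟨x, y⟩ hx
    by_cases hxy : edist x y ≤ ENNReal.ofReal δ
    · exact Or.inl (Metric.mem_cthickening_of_edist_le y x δ F hx (by rwa [edist_comm]))
    · exact Or.inr (ENNReal.rpow_le_rpow (not_le.1 hxy).le hp.le)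
  calc Φ₀ F = (Φ₀ - M.fst) F + M.fst F := by
        rw [← Measure.add_apply, Measure.sub_add_cancel_of_le h₀]
    _ ≤ ε / 2 + (M.snd (Metric.cthickening δ F) + ε / 2) := by
        rw [Measure.fst_apply hF, Measure.snd_apply Metric.isClosed_cthickening.measurableSet]
        gcongr
        exact (measure_mono hsub).trans ((measure_union_le _ _).trans (by gcongr))
    _ = M.snd (Metric.cthickening δ F) + ε := by
        rw [add_left_comm, ENNReal.add_halves]
    _ ≤ _ := by gcongr

lemma eq_of_Skappa_eq_zero {p κ : ℝ} (hp : 0 < p) (hκ : 0 < κ) {Φ₀ Φ₁ : Measure Tcircle}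
    [IsFiniteMeasure Φ₀] [IsFiniteMeasure Φ₁] (h : Skappa p κ Φ₀ Φ₁ = 0) : Φ₀ = Φ₁ := by
  have key {Φ Ψ : Measure Tcircle} [IsFiniteMeasure Φ] [IsFiniteMeasure Ψ]
      (h : Skappa p κ Φ Ψ = 0) {F : Set Tcircle} (hF : IsClosed F) : Φ F ≤ Ψ F := by
    have hlim := (tendsto_measure_cthickening_of_isClosed (μ := Ψ) (s := F)
      ⟨1, one_pos, measure_ne_top _ _⟩ hF).mono_left (nhdsWithin_le_nhds (s := Set.Ioi 0))
    refine ge_of_tendsto hlim ?_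
    filter_upwards [self_mem_nhdsWithin] with δ hδ
    exact measure_le_cthickening_of_Skappa_eq_zero hp hκ h hF.measurableSet hδ
  have heq {F : Set Tcircle} (hF : IsClosed F) : Φ₀ F = Φ₁ F :=
    le_antisymm (key h hF) (key (by rw [Skappa_comm, h]) hF)
  refine ext_of_generate_finite {F : Set Tcircle | IsClosed F} ?_ isPiSystem_isClosed
    (fun F hF => heq hF) (heq isClosed_univ)
  rw [← borel_eq_generateFrom_isClosed]
  exact BorelSpace.measurable_eq

/-- for `p ≥ 1` and `κ > 0`, `W_κ` is a metric on the non-negative bounded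
measures on the circle: non-negative, symmetric, vanishing exactly for equal arguments, and
satisfying the triangle inequality. -/
theorem Wkappa_is_metric (p κ : ℝ) (hp : 1 ≤ p) (hκ : 0 < κ) :
    (∀ (Φ₀ Φ₁ : Measure Tcircle), 0 ≤ Wkappa p κ Φ₀ Φ₁) ∧
    (∀ (Φ₀ Φ₁ : Measure Tcircle), Wkappa p κ Φ₀ Φ₁ = Wkappa p κ Φ₁ Φ₀) ∧
    (∀ (Φ₀ Φ₁ : Measure Tcircle), IsFiniteMeasure Φ₀ → IsFiniteMeasure Φ₁ →
      (Wkappa p κ Φ₀ Φ₁ = 0 ↔ Φ₀ = Φ₁)) ∧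
    (∀ (Φ₀ Φ₁ Φ₂ : Measure Tcircle), IsFiniteMeasure Φ₀ → IsFiniteMeasure Φ₁ →
      IsFiniteMeasure Φ₂ →
      Wkappa p κ Φ₀ Φ₂ ≤ Wkappa p κ Φ₀ Φ₁ + Wkappa p κ Φ₁ Φ₂) := by
  have hp0 : 0 < p := by linarith
  refine ⟨fun _ _ => zero_le, fun Φ₀ Φ₁ => by rw [Wkappa, Wkappa, Skappa_comm],
    fun Φ₀ Φ₁ _ _ => ⟨fun h => eq_of_Skappa_eq_zero hp0 hκ ?_, ?_⟩,
    fun Φ₀ Φ₁ Φ₂ _ _ _ => Wkappa_triangle hp hκ Φ₀ Φ₁ Φ₂⟩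
  · exact (ENNReal.rpow_eq_zero_iff_of_pos (by positivity)).1 h
  · rintro rfl
    rw [Wkappa, Skappa_self hp0, ENNReal.zero_rpow_of_pos (by positivity)]
end

section
/- Let c be continuous, non-negative, shift-invariant (c(θ−ϕ,φ−ϕ) = c(θ,φ) for all ϕ), with c(θ,θ)=0. Then T_κ is contractive with respect to multiplicative noise: if R_w is a positive semi-definite Toeplitz matrix with diagonal elements at most 1, then T_κ(R₀ ⊙ R_w, R₁ ⊙ R_w) ≤ T_κ(R₀, R₁), where ⊙ denotes the Hadamard (entrywise) product. -/
open MeasureTheory Matrix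
open scoped ENNReal ComplexOrder

/-- The Fourier vector `a(θ) = (1, e^{iθ}, ..., e^{i(n-1)θ})` on the circle. -/
noncomputable def aVecC (n : ℕ) (θ : Tcircle) : Fin n → ℂ :=
  fun k => fourier (k : ℤ) θ

/-- `Γ(Φ) = (1/2π) ∫ a(θ) a(θ)ᴴ dΦ(θ)`, entrywise `Γ(Φ)_{jk} = (1/2π) ∫ e^{i(j-k)θ} dΦ`. -/
noncomputable def GammaC (n : ℕ) (μ : Measure Tcircle) : Matrix (Fin n) (Fin n) ℂ :=
  Matrix.of fun j k : Fin n =>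
    ((1 / (2 * Real.pi) : ℝ) : ℂ) * ∫ θ, fourier ((j : ℤ) - (k : ℤ)) θ ∂μ

/-- The adjoint map `Γ*(Λ)(θ) = (1/2π) a(θ)ᴴ Λ a(θ)`. -/
noncomputable def GammaStarC (n : ℕ) (Λ : Matrix (Fin n) (Fin n) ℂ) (θ : Tcircle) : ℂ :=
  ((1 / (2 * Real.pi) : ℝ) : ℂ) * (star (aVecC n θ) ⬝ᵥ (Λ *ᵥ aVecC n θ))

/-- The dual characterization of `T_κ(R₀,R₁)`: the supremum of
`⟨Λ₀,R₀⟩ + ⟨Λ₁,R₁⟩` over Hermitian pairs `(Λ₀,Λ₁)` with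
`Γ*(Λ₀)(θ) + Γ*(Λ₁)(φ) ≤ c(θ,φ)` and `Γ*(Λ_j) ≤ κ` pointwise. -/
noncomputable def Tdual (n : ℕ) (c : Tcircle → Tcircle → ℝ) (κ : ℝ)
    (R₀ R₁ : Matrix (Fin n) (Fin n) ℂ) : ℝ :=
  sSup { x | ∃ Λ₀ Λ₁ : Matrix (Fin n) (Fin n) ℂ, Λ₀.IsHermitian ∧ Λ₁.IsHermitian ∧
      (∀ θ φ : Tcircle, (GammaStarC n Λ₀ θ).re + (GammaStarC n Λ₁ φ).re ≤ c θ φ) ∧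
      (∀ θ : Tcircle, (GammaStarC n Λ₀ θ).re ≤ κ) ∧
      (∀ φ : Tcircle, (GammaStarC n Λ₁ φ).re ≤ κ) ∧
      x = (Matrix.trace (Λ₀ * R₀ᴴ)).re + (Matrix.trace (Λ₁ * R₁ᴴ)).re }

/-- The autocorrelation sequence of a vector under a linear isometry of a finite-dimensional
complex inner product space is a finite positive combination of characters. -/
theorem LinearIsometry.exists_inner_iterate_eq_sum (d : ℕ) :
    ∀ (E : Type) [NormedAddCommGroup E] [InnerProductSpace ℂ E] [FiniteDimensional ℂ E],
      Module.finrank ℂ E = d → ∀ (U : E →ₗᵢ[ℂ] E) (v : E),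
      ∃ (m : ℕ) (w : Fin m → ℝ) (z : Fin m → Circle), (∀ l, 0 ≤ w l) ∧
        ∀ j k : ℕ, inner ℂ (U^[j] v) (U^[k] v) =
          ∑ l, (w l : ℂ) * ((z l ^ ((k : ℤ) - (j : ℤ)) : Circle) : ℂ) := by
  induction d with
  | zero =>
    intro E _ _ _ hE U v
    have := Module.finrank_zero_iff.mp hE
    refine ⟨0, Fin.elim0, Fin.elim0, fun l => l.elim0, fun j k => ?_⟩
    rw [Subsingleton.elim (U^[j] v) 0]
    simp
  | succ d ih =>
    intro E _ _ _ hE U v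
    have : Nontrivial E := Module.nontrivial_of_finrank_eq_succ hE
    obtain ⟨μ, hμ⟩ := Module.End.exists_eigenvalue U.toLinearMap
    obtain ⟨x, hx⟩ := hμ.exists_hasEigenvector
    have hx0 : ‖x‖ ≠ 0 := norm_ne_zero_iff.mpr hx.2
    have hUx : U x = μ • x := hx.apply_eq_smul
    have hμ1 : ‖μ‖ = 1 := by
      have h := U.norm_map x
      rw [hUx, norm_smul] at h
      exact mul_right_cancel₀ hx0 (by rw [h, one_mul])
    let ζ : Circle := ⟨μ, mem_sphere_zero_iff_norm.mpr hμ1⟩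
    have hμ0 : μ ≠ 0 := norm_ne_zero_iff.mp (by rw [hμ1]; exact one_ne_zero)
    have hinv : ∀ y ∈ (ℂ ∙ x)ᗮ, U.toLinearMap y ∈ (ℂ ∙ x)ᗮ := by
      intro y hy
      rw [Submodule.mem_orthogonal_singleton_iff_inner_right] at hy ⊢
      have h := U.inner_map_map x y
      rw [hUx, hy, inner_smul_left] at h
      exact (mul_eq_zero.mp h).resolve_left (by simpa using hμ0)
    let U' : (ℂ ∙ x)ᗮ →ₗᵢ[ℂ] (ℂ ∙ x)ᗮ :=
      { toLinearMap := U.toLinearMap.restrict hinv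
        norm_map' := fun y => U.norm_map y }
    have hU' : ∀ (j : ℕ) (y : (ℂ ∙ x)ᗮ), ((U'^[j] y : (ℂ ∙ x)ᗮ) : E) = U^[j] (y : E) := by
      intro j
      induction j with
      | zero => intro y; rfl
      | succ j ihj => intro y; rw [Function.iterate_succ_apply, Function.iterate_succ_apply, ihj]; rfl
    have hUxj : ∀ (j : ℕ) (a : ℂ), U^[j] (a • x) = (μ ^ j * a) • x := by
      intro j a
      induction j with
      | zero => simp
      | succ j ihj =>
        rw [Function.iterate_succ_apply', ihj, map_smul, hUx, smul_smul]
        congr 1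
        ring
    have hadd : ∀ (j : ℕ) (a b : E), U^[j] (a + b) = U^[j] a + U^[j] b := by
      intro j a b
      induction j with
      | zero => rfl
      | succ j ihj => simp only [Function.iterate_succ_apply', ihj, map_add]
    have hfin : Module.finrank ℂ (ℂ ∙ x)ᗮ = d := by
      have : Fact (Module.finrank ℂ E = d + 1) := ⟨hE⟩
      exact Submodule.finrank_orthogonal_span_singleton hx.2
    obtain ⟨y, hy, y', hy', hv⟩ := (ℂ ∙ x).exists_add_mem_mem_orthogonal v
    obtain ⟨a, rfl⟩ := Submodule.mem_span_singleton.mp hy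
    obtain ⟨m, w, z, hw, h⟩ := ih (ℂ ∙ x)ᗮ hfin U' ⟨y', hy'⟩
    refine ⟨m + 1, Fin.cons (‖a‖ ^ 2 * ‖x‖ ^ 2) w, Fin.cons ζ z, ?_, fun j k => ?_⟩
    · intro l
      refine Fin.cases ?_ (fun i => ?_) l
      · simp only [Fin.cons_zero]; positivity
      · simpa using hw i
    · rw [Fin.sum_univ_succ]
      simp only [Fin.cons_zero, Fin.cons_succ]
      rw [← h j k, Submodule.coe_inner, hU', hU', hv, hadd, hadd, hUxj, hUxj]
      have ho : ∀ i : ℕ, inner ℂ x (U^[i] y') = 0 := fun i => by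
        have := (U'^[i] ⟨y', hy'⟩).2
        rw [hU'] at this
        exact (Submodule.mem_orthogonal_singleton_iff_inner_right).mp this
      have ho' : ∀ i : ℕ, inner ℂ (U^[i] y') x = 0 := fun i => inner_eq_zero_symm.mp (ho i)
      have hz : ((ζ ^ ((k : ℤ) - (j : ℤ)) : Circle) : ℂ) = (starRingEnd ℂ) μ ^ j * μ ^ k := by
        have hconj : (starRingEnd ℂ) μ = μ⁻¹ := (Complex.inv_eq_conj hμ1).symm
        rw [Circle.coe_zpow, hconj, sub_eq_add_neg, zpow_add₀ hμ0]
        simp [mul_comm]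
      rw [hz]
      simp only [inner_add_left, inner_add_right, inner_smul_left, inner_smul_right, ho, ho',
        mul_zero, add_zero, zero_add, inner_self_eq_norm_sq_to_K, map_mul, map_pow]
      have ha : (starRingEnd ℂ) a * a = (‖a‖ : ℂ) ^ 2 := Complex.conj_mul' a
      push_cast
      rw [← ha]
      simp only [Complex.coe_algebraMap]
      ring

/-- Two finite families with the same Gram matrix in a finite-dimensional space are related by a
linear isometry. -/
theorem LinearIsometry.exists_map_eq_of_inner_eq {E : Type*} [NormedAddCommGroup E]
    [InnerProductSpace ℂ E] [FiniteDimensional ℂ E] {ι : Type*} [Fintype ι] (v w : ι → E)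
    (h : ∀ i j, inner ℂ (v i) (v j) = inner ℂ (w i) (w j)) :
    ∃ U : E →ₗᵢ[ℂ] E, ∀ i, U (v i) = w i := by
  classical
  let L := Fintype.linearCombination ℂ v
  let L' := Fintype.linearCombination ℂ w
  have hnorm : ∀ c, ‖L c‖ = ‖L' c‖ := by
    intro c
    have : inner ℂ (L c) (L c) = inner ℂ (L' c) (L' c) := by
      simp only [L, L', Fintype.linearCombination_apply, sum_inner, inner_sum, inner_smul_left,
        inner_smul_right, h]
    rw [@norm_eq_sqrt_re_inner ℂ, @norm_eq_sqrt_re_inner ℂ _ _ _ _ (L' c), this]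
  obtain ⟨g, hg⟩ := L.rangeRestrict.exists_rightInverse_of_surjective L.range_rangeRestrict
  have hLg : ∀ y, L (g y) = y := fun y => congrArg Subtype.val (LinearMap.congr_fun hg y)
  let S : LinearMap.range L →ₗᵢ[ℂ] E :=
    { toLinearMap := L' ∘ₗ g
      norm_map' := fun y => by
        rw [LinearMap.comp_apply, ← hnorm, hLg]; rfl }
  refine ⟨S.extend, fun i => ?_⟩
  have hv : L (Pi.single i 1) = v i := by simp [L]
  have hw : L' (Pi.single i 1) = w i := by simp [L']
  have hmem : v i ∈ LinearMap.range L := ⟨_, hv⟩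
  rw [show v i = ((⟨v i, hmem⟩ : LinearMap.range L) : E) from rfl, LinearIsometry.extend_apply]
  change L' (g ⟨v i, hmem⟩) = w i
  rw [← hw, ← sub_eq_zero, ← map_sub, ← norm_eq_zero, ← hnorm, map_sub, hLg, hv, sub_self,
    norm_zero]

/-- Carathéodory: a positive semidefinite Toeplitz matrix is the moment matrix of a finitely
supported nonnegative measure on the circle. -/
theorem IsToeplitz.exists_eq_sum_fourier {n : ℕ} {R : Matrix (Fin n) (Fin n) ℂ}
    (hT : IsToeplitz R) (hR : R.PosSemidef) :
    ∃ (m : ℕ) (w : Fin m → ℝ) (θ : Fin m → Tcircle), (∀ l, 0 ≤ w l) ∧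
      ∀ j k : Fin n, R j k = ∑ l, (w l : ℂ) * fourier ((k : ℤ) - (j : ℤ)) (θ l) := by
  obtain _ | n := n
  · exact ⟨0, Fin.elim0, Fin.elim0, fun l => l.elim0, fun j => j.elim0⟩
  obtain ⟨B, rfl⟩ : ∃ B : Matrix (Fin (n + 1)) (Fin (n + 1)) ℂ, R = Bᴴ * B := by
    open scoped MatrixOrder Matrix.Norms.L2Operator in
    exact CStarAlgebra.nonneg_iff_eq_star_mul_self.mp hR.nonneg
  let v : Fin (n + 1) → EuclideanSpace ℂ (Fin (n + 1)) := fun j => WithLp.toLp 2 (fun i => B i j)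
  have hv : ∀ j k, inner ℂ (v j) (v k) = (Bᴴ * B) j k := by
    intro j k
    simp [v, PiLp.inner_apply, Matrix.mul_apply, mul_comm]
  obtain ⟨U, hU⟩ := LinearIsometry.exists_map_eq_of_inner_eq
    (fun i : Fin n => v i.castSucc) (fun i : Fin n => v i.succ) (fun i j => by
      rw [hv, hv]
      apply hT
      simp)
  have hUv : ∀ j (hj : j < n + 1), U^[j] (v 0) = v ⟨j, hj⟩ := by
    intro j
    induction j with
    | zero => intro _; rfl
    | succ j ih =>
      intro hj
      rw [Function.iterate_succ_apply', ih (by omega)]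
      exact hU ⟨j, by omega⟩
  obtain ⟨m, w, z, hw, h⟩ := LinearIsometry.exists_inner_iterate_eq_sum _ _ rfl U (v 0)
  have hsurj : ∀ z : Circle, ∃ θ : Tcircle, AddCircle.toCircle θ = z := by
    intro z
    obtain ⟨x, rfl⟩ := Circle.exp_surjective z
    refine ⟨(x : Tcircle), ?_⟩
    rw [AddCircle.toCircle_apply_mk, div_self Real.two_pi_pos.ne', one_mul]
  choose θ hθ using hsurj
  refine ⟨m, w, fun l => θ (z l), hw, fun j k => ?_⟩
  have hjk := h j k
  rw [hUv j j.2, hUv k k.2, hv] at hjk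
  rw [hjk]
  simp only [fourier_apply, AddCircle.toCircle_zsmul, hθ]

theorem GammaStarC_eq_sum (n : ℕ) (Λ : Matrix (Fin n) (Fin n) ℂ) (θ : Tcircle) :
    GammaStarC n Λ θ = ((1 / (2 * Real.pi) : ℝ) : ℂ) *
      ∑ j : Fin n, ∑ k : Fin n, Λ j k * fourier ((k : ℤ) - (j : ℤ)) θ := by
  rw [GammaStarC]
  congr 1
  simp only [dotProduct, mulVec, aVecC, Pi.star_apply, Finset.mul_sum]
  refine Finset.sum_congr rfl fun j _ => Finset.sum_congr rfl fun k _ => ?_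
  rw [sub_eq_add_neg, fourier_add, fourier_neg, Complex.star_def]
  ring

theorem trace_mul_conjTranspose_eq_sum {n : ℕ} (A B : Matrix (Fin n) (Fin n) ℂ) :
    Matrix.trace (A * Bᴴ) = ∑ j, ∑ k, A j k * star (B j k) := by
  simp [Matrix.trace, Matrix.mul_apply]

theorem fourier_neg_arg (i : ℤ) (x : Tcircle) : fourier i (-x) = fourier (-i) x := by
  simp only [fourier_apply, smul_neg, neg_smul]

theorem fourier_arg_add (i : ℤ) (x y : Tcircle) :
    fourier i (x + y) = fourier i x * fourier i y := by
  simp only [fourier_apply, smul_add, AddCircle.toCircle_add, Circle.coe_mul]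

section Moments

variable {n m : ℕ} {R : Matrix (Fin n) (Fin n) ℂ} {w : Fin m → ℝ} {θ : Fin m → Tcircle}

theorem star_eq_sum_fourier
    (h : ∀ j k : Fin n, R j k = ∑ l, (w l : ℂ) * fourier ((k : ℤ) - (j : ℤ)) (θ l))
    (j k : Fin n) : star (R j k) = ∑ l, (w l : ℂ) * fourier ((j : ℤ) - (k : ℤ)) (θ l) := by
  rw [h, star_sum]
  refine Finset.sum_congr rfl fun l _ => ?_
  rw [← neg_sub (k : ℤ) (j : ℤ), fourier_neg, Complex.star_def, map_mul, Complex.conj_ofReal]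

/-- Multiplying `Λ` entrywise by the conjugate of a moment matrix averages `Γ*(Λ)` over
translates. -/
theorem GammaStarC_hadamard
    (h : ∀ j k : Fin n, R j k = ∑ l, (w l : ℂ) * fourier ((k : ℤ) - (j : ℤ)) (θ l))
    (Λ : Matrix (Fin n) (Fin n) ℂ) (x : Tcircle) :
    (GammaStarC n (Λ.hadamard (R.map star)) x).re =
      ∑ l, w l * (GammaStarC n Λ (x - θ l)).re := by
  have : GammaStarC n (Λ.hadamard (R.map star)) x =
      ∑ l, (w l : ℂ) * GammaStarC n Λ (x - θ l) := by
    simp only [GammaStarC_eq_sum, hadamard_apply, map_apply, star_eq_sum_fourier h,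
      Finset.mul_sum, Finset.sum_mul]
    conv_rhs => rw [Finset.sum_comm]
    refine Finset.sum_congr rfl fun j _ => ?_
    conv_rhs => rw [Finset.sum_comm]
    refine Finset.sum_congr rfl fun k _ => Finset.sum_congr rfl fun l _ => ?_
    rw [sub_eq_add_neg x, fourier_arg_add, fourier_neg_arg, neg_sub]
    ring
  rw [this, Complex.re_sum]
  simp only [Complex.re_ofReal_mul]

/-- The pairing of `Λ` with a moment matrix is the integral of `Γ*(Λ)`. -/
theorem re_trace_eq_sum_GammaStarC
    (h : ∀ j k : Fin n, R j k = ∑ l, (w l : ℂ) * fourier ((k : ℤ) - (j : ℤ)) (θ l))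
    (Λ : Matrix (Fin n) (Fin n) ℂ) :
    (Matrix.trace (Λ * Rᴴ)).re = 2 * Real.pi * ∑ l, w l * (GammaStarC n Λ (-θ l)).re := by
  have h0 := GammaStarC_hadamard h Λ 0
  simp only [zero_sub] at h0
  rw [← h0, GammaStarC_eq_sum, trace_mul_conjTranspose_eq_sum, Complex.re_ofReal_mul]
  simp only [fourier_eval_zero, mul_one, hadamard_apply, map_apply]
  field_simp

end Moments

theorem trace_mul_conjTranspose_hadamard {n : ℕ} (Λ R S : Matrix (Fin n) (Fin n) ℂ) :
    Matrix.trace (Λ * (R.hadamard S)ᴴ) = Matrix.trace (Λ.hadamard (S.map star) * Rᴴ) := by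
  simp only [trace_mul_conjTranspose_eq_sum, hadamard_apply, map_apply, star_mul, mul_assoc]

theorem exists_re_trace_le {n : ℕ} {R : Matrix (Fin n) (Fin n) ℂ} (hR : R.PosSemidef)
    (hT : IsToeplitz R) (κ : ℝ) :
    ∃ b : ℝ, ∀ Λ : Matrix (Fin n) (Fin n) ℂ, (∀ θ, (GammaStarC n Λ θ).re ≤ κ) →
      (Matrix.trace (Λ * Rᴴ)).re ≤ b := by
  obtain ⟨m, w, θ, hw, h⟩ := hT.exists_eq_sum_fourier hR
  refine ⟨2 * Real.pi * ∑ l, w l * κ, fun Λ hΛ => ?_⟩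
  rw [re_trace_eq_sum_GammaStarC h]
  exact mul_le_mul_of_nonneg_left
    (Finset.sum_le_sum fun l _ => mul_le_mul_of_nonneg_left (hΛ _) (hw l)) Real.two_pi_pos.le

theorem Matrix.IsHermitian.hadamard_map_star {n : ℕ} {Λ S : Matrix (Fin n) (Fin n) ℂ}
    (hΛ : Λ.IsHermitian) (hS : S.IsHermitian) : (Λ.hadamard (S.map star)).IsHermitian := by
  ext j k
  rw [conjTranspose_apply, hadamard_apply, hadamard_apply, map_apply, map_apply, star_mul',
    hΛ.apply, hS.apply]

/-- `T_κ` is contractive with respect to multiplicative noise: if `R_w` is a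
positive semi-definite Toeplitz matrix with diagonal elements at most `1`, then
`T_κ(R₀ ⊙ R_w, R₁ ⊙ R_w) ≤ T_κ(R₀, R₁)`, where `⊙` is the Hadamard product. -/
theorem Tkappa_contractive_multiplicative (n : ℕ) (c : Tcircle → Tcircle → ℝ) (κ : ℝ)
    (hκ : 0 < κ)
    (hc_cont : Continuous fun p : Tcircle × Tcircle => c p.1 p.2)
    (hc_nonneg : ∀ θ φ, 0 ≤ c θ φ) (hc_diag : ∀ θ, c θ θ = 0)
    (hc_shift : ∀ ϕ θ φ : Tcircle, c (θ - ϕ) (φ - ϕ) = c θ φ)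
    (R₀ R₁ Rw : Matrix (Fin n) (Fin n) ℂ)
    (h₀ : R₀.PosSemidef) (hT₀ : IsToeplitz R₀)
    (h₁ : R₁.PosSemidef) (hT₁ : IsToeplitz R₁)
    (hw : Rw.PosSemidef) (hTw : IsToeplitz Rw)
    (hdiag : ∀ i : Fin n, (Rw i i).re ≤ 1) :
    Tdual n c κ (R₀.hadamard Rw) (R₁.hadamard Rw) ≤ Tdual n c κ R₀ R₁ := by
  obtain rfl | hn := Nat.eq_zero_or_pos n
  · rw [Subsingleton.elim (R₀.hadamard Rw) R₀, Subsingleton.elim (R₁.hadamard Rw) R₁]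
  obtain ⟨m, w, ϑ, hw0, hwsum⟩ := hTw.exists_eq_sum_fourier hw
  have hmass : ∑ l, w l ≤ 1 := by
    have h := hdiag ⟨0, hn⟩
    rw [hwsum, Complex.re_sum] at h
    simpa using h
  have hle : ∀ (f : Fin m → ℝ) (b : ℝ), 0 ≤ b → (∀ l, f l ≤ b) → ∑ l, w l * f l ≤ b := by
    intro f b hb hf
    calc ∑ l, w l * f l ≤ ∑ l, w l * b :=
          Finset.sum_le_sum fun l _ => mul_le_mul_of_nonneg_left (hf l) (hw0 l)
      _ = (∑ l, w l) * b := (Finset.sum_mul ..).symm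
      _ ≤ b := mul_le_of_le_one_left hb hmass
  apply csSup_le_csSup
  · obtain ⟨b₀, hb₀⟩ := exists_re_trace_le h₀ hT₀ κ
    obtain ⟨b₁, hb₁⟩ := exists_re_trace_le h₁ hT₁ κ
    refine ⟨b₀ + b₁, ?_⟩
    rintro x ⟨Λ₀, Λ₁, -, -, -, hκ₀, hκ₁, rfl⟩
    exact add_le_add (hb₀ Λ₀ hκ₀) (hb₁ Λ₁ hκ₁)
  · refine ⟨_, 0, 0, isHermitian_zero, isHermitian_zero, ?_, ?_, ?_, rfl⟩
    · simpa [GammaStarC] using hc_nonneg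
    · simpa [GammaStarC] using hκ.le
    · simpa [GammaStarC] using hκ.le
  · rintro x ⟨Λ₀, Λ₁, hΛ₀, hΛ₁, hcost, hκ₀, hκ₁, rfl⟩
    refine ⟨Λ₀.hadamard (Rw.map star), Λ₁.hadamard (Rw.map star),
      hΛ₀.hadamard_map_star hw.isHermitian, hΛ₁.hadamard_map_star hw.isHermitian,
      fun θ φ => ?_, fun θ => ?_, fun φ => ?_, ?_⟩
    · rw [GammaStarC_hadamard hwsum, GammaStarC_hadamard hwsum, ← Finset.sum_add_distrib]
      simp only [← mul_add]
      exact hle _ _ (hc_nonneg θ φ) fun l => (hcost _ _).trans_eq (hc_shift _ _ _)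
    · rw [GammaStarC_hadamard hwsum]
      exact hle _ _ hκ.le fun l => hκ₀ _
    · rw [GammaStarC_hadamard hwsum]
      exact hle _ _ hκ.le fun l => hκ₁ _
    · rw [trace_mul_conjTranspose_hadamard, trace_mul_conjTranspose_hadamard]
end
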